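/- arXiv:2410.17817 — 7 statements merged into one kernel-verified Lean document; each statement's English description precedes it below -/
import Mathlib

section
/- The automorphism φ₀ of the free group F₃ on generators a, b, c determined by a ↦ b, b ↦ c, c ↦ c·a⁻¹ is atoroidal: for every integer n ≥ 1 and every element w ≠ 1 of F₃, the element φ₀ⁿ(w) is not conjugate to w in F₃. -/
/-- The free-by-cyclic group `FreeGroup (Fin r) ⋊_φ ℤ`, the semidirect product with
respect to the homomorphism `ℤ → Aut(F_r)` sending `1` to `φ`. -/
abbrev FreeByCyclic {r : ℕ} (φ : MulAut (FreeGroup (Fin r))) : Type :=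
  SemidirectProduct (FreeGroup (Fin r)) (Multiplicative ℤ)
    (zpowersHom (MulAut (FreeGroup (Fin r))) φ)

/-- Two groups have the same finite quotients if every finite group is a quotient of one
iff it is a quotient of the other. -/
def SameFiniteQuotients (G H : Type*) [Group G] [Group H] : Prop :=
  ∀ (Q : Type) (_ : Group Q) (_ : Finite Q),
    (∃ f : G →* Q, Function.Surjective f) ↔ ∃ f : H →* Q, Function.Surjective f

/-- The map on generators defining `φ₀ : a ↦ b, b ↦ c, c ↦ c·a⁻¹`. -/
def phi0Fun : Fin 3 → FreeGroup (Fin 3)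
  | 0 => FreeGroup.of 1
  | 1 => FreeGroup.of 2
  | 2 => FreeGroup.of 2 * (FreeGroup.of 0)⁻¹

/-- The map on generators defining `φ₀⁻¹ : a ↦ c⁻¹·b, b ↦ a, c ↦ b`. -/
def phi0InvFun : Fin 3 → FreeGroup (Fin 3)
  | 0 => (FreeGroup.of 2)⁻¹ * FreeGroup.of 1
  | 1 => FreeGroup.of 0
  | 2 => FreeGroup.of 1

/-- The automorphism `φ₀` of `F₃` determined by `a ↦ b, b ↦ c, c ↦ c·a⁻¹`. -/
def phi0 : MulAut (FreeGroup (Fin 3)) :=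
  MonoidHom.toMulEquiv (FreeGroup.lift phi0Fun) (FreeGroup.lift phi0InvFun)
    (by ext i; fin_cases i <;> simp [phi0Fun, phi0InvFun])
    (by ext i; fin_cases i <;> simp [phi0Fun, phi0InvFun])

/-- `φ` and `ψ` represent conjugate elements of `Out(F_r)`. -/
def OutConj {r : ℕ} (φ ψ : MulAut (FreeGroup (Fin r))) : Prop :=
  ∃ (σ : MulAut (FreeGroup (Fin r))) (g : FreeGroup (Fin r)),
    ∀ x, ψ x = g * σ (φ (σ.symm x)) * g⁻¹

/-- An automorphism is atoroidal if no positive power sends a nontrivial element to a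
conjugate of itself. -/
def Atoroidal {r : ℕ} (φ : MulAut (FreeGroup (Fin r))) : Prop :=
  ∀ n : ℕ, 1 ≤ n → ∀ w : FreeGroup (Fin r), w ≠ 1 → ¬ IsConj w ((φ ^ n) w)

/-- The cyclically reduced length of `w`: the minimum reduced word length among
conjugates of `w`. -/
noncomputable def cycLength {r : ℕ} (w : FreeGroup (Fin r)) : ℕ :=
  sInf { n | ∃ g : FreeGroup (Fin r), (g * w * g⁻¹).toWord.length = n }

/-- The stretch factor `λ(φ) = sup_w limsup_n ‖φⁿ(w)‖^(1/n)`. -/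
noncomputable def stretchFactor {r : ℕ} (φ : MulAut (FreeGroup (Fin r))) : ℝ :=
  ⨆ w : FreeGroup (Fin r),
    Filter.limsup (fun n : ℕ => (cycLength ((φ ^ n) w) : ℝ) ^ (1 / (n : ℝ))) Filter.atTop

/-- A group has first Betti number 1 if it surjects onto `ℤ` but not onto `ℤ × ℤ`. -/
def FirstBettiOne (G : Type*) [Group G] : Prop :=
  (∃ f : G →* Multiplicative ℤ, Function.Surjective f) ∧
    ¬ ∃ f : G →* Multiplicative (ℤ × ℤ), Function.Surjective f

namespace PhiZero

/-! ### A positive automorphism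

In the basis `x = a`, `y = b⁻¹`, `z = c` the automorphism `φ₀⁻²` is the positive substitution
`x ↦ yx`, `y ↦ yz`, `z ↦ x`.  Words in `x, y, z` are encoded as lists over `Fin 3`. -/

/-- The letter of `FreeGroup (Fin 3)` standing for the positive generator `i`. -/
def posLetter (i : Fin 3) : Fin 3 × Bool := (i, i != 1)

/-- The inverse letter of `posLetter i`. -/
def negLetter (i : Fin 3) : Fin 3 × Bool := (i, i == 1)

/-- The group element represented by a positive word. -/
def posWord (u : List (Fin 3)) : FreeGroup (Fin 3) := FreeGroup.mk (u.map posLetter)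

@[simp] lemma posWord_nil : posWord [] = 1 := rfl

lemma posWord_append (u v : List (Fin 3)) : posWord (u ++ v) = posWord u * posWord v := by
  simp [posWord, FreeGroup.mul_mk]

lemma posWord_cons (i : Fin 3) (u : List (Fin 3)) : posWord (i :: u) = posWord [i] * posWord u :=
  posWord_append [i] u

lemma posWord_inv (v : List (Fin 3)) :
    (posWord v)⁻¹ = FreeGroup.mk (v.reverse.map negLetter) := by
  rw [posWord, FreeGroup.inv_mk, FreeGroup.invRev, List.map_map, ← List.map_reverse]
  congr 2
  funext i
  fin_cases i <;> rfl

/-- The substitution on letters. -/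
def substLetter : Fin 3 → List (Fin 3)
  | 0 => [1, 0]
  | 1 => [1, 2]
  | 2 => [0]

/-- The substitution on positive words. -/
def substWord (u : List (Fin 3)) : List (Fin 3) := u.flatMap substLetter

@[simp] lemma substWord_nil : substWord [] = [] := rfl

lemma substWord_cons (i : Fin 3) (u : List (Fin 3)) :
    substWord (i :: u) = substLetter i ++ substWord u := by simp [substWord]

lemma substWord_append (u v : List (Fin 3)) :
    substWord (u ++ v) = substWord u ++ substWord v := by simp [substWord]

/-- The positive automorphism `φ₀⁻²`. -/
def psi : MulAut (FreeGroup (Fin 3)) := phi0⁻¹ ^ 2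

lemma phi0_symm_of (i : Fin 3) : phi0.symm (FreeGroup.of i) = phi0InvFun i :=
  FreeGroup.lift_apply_of

lemma psi_apply (w : FreeGroup (Fin 3)) : psi w = phi0.symm (phi0.symm w) := by
  rw [psi, pow_two]; rfl

lemma psi_posWord (u : List (Fin 3)) : psi (posWord u) = posWord (substWord u) := by
  have h0 : posWord [0] = FreeGroup.of 0 := rfl
  have h1 : posWord [1] = (FreeGroup.of 1)⁻¹ := rfl
  have h2 : posWord [2] = FreeGroup.of 2 := rfl
  induction u with
  | nil => simp
  | cons i u ih =>
    rw [posWord_cons, map_mul, ih, substWord_cons, posWord_append]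
    congr 1
    rw [psi_apply]
    fin_cases i <;>
      simp [substLetter, posWord_cons _ [_], h0, h1, h2, phi0_symm_of, phi0InvFun]

/-! ### Products along an integer-indexed sequence -/

section PartialProd

variable {G : Type*} [Group G]

/-- The product `f 0 * f 1 * ⋯ * f (k - 1)`. -/
def partialProd (f : ℤ → G) : ℕ → G
  | 0 => 1
  | k + 1 => partialProd f k * f k

lemma partialProd_congr {f g : ℤ → G} {k : ℕ} (h : ∀ i : ℕ, i < k → f i = g i) :
    partialProd f k = partialProd g k := by
  induction k with
  | zero => rfl
  | succ k ih =>
    rw [partialProd, partialProd, ih fun i hi => h i (by omega), h k (by omega)]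

lemma partialProd_telescope {f g h : ℤ → G} (H : ∀ i, f i = g i * h i * (g (i + 1))⁻¹) (k : ℕ) :
    partialProd f k = g 0 * partialProd h k * (g k)⁻¹ := by
  induction k with
  | zero => simp [partialProd]
  | succ k ih =>
    rw [partialProd, partialProd, ih, H]
    push_cast
    group

lemma partialProd_mul_period {f : ℤ → G} {m : ℕ} (hf : ∀ i, f (i + m) = f i) (k : ℕ) :
    partialProd f (m * k) = partialProd f m ^ k := by
  have hmul : ∀ k : ℕ, ∀ i, f (i + (m * k : ℕ)) = f i := by
    intro k
    induction k with
    | zero => simp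
    | succ k ih =>
      intro i
      rw [← ih i, ← hf (i + (m * k : ℕ))]
      congr 1
      push_cast
      ring
  have hadd : ∀ k j : ℕ, partialProd f (m * k + j) = partialProd f (m * k) * partialProd f j := by
    intro k j
    induction j with
    | zero => simp [partialProd]
    | succ j ih =>
      rw [← Nat.add_assoc, partialProd, partialProd, ih, mul_assoc, ← hmul k j]
      push_cast
      rw [add_comm (j : ℤ)]
  induction k with
  | zero => simp [partialProd]
  | succ k ih =>
    rw [Nat.mul_succ, hadd, ih, pow_succ]

end PartialProd

/-! ### Cyclic alternating representatives -/

/-- The group element `U i * (V i)⁻¹`. -/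
def seg (U V : ℤ → List (Fin 3)) (i : ℤ) : FreeGroup (Fin 3) := posWord (U i) * (posWord (V i))⁻¹

/-- `w` is conjugate to the product of the `m` elements `U i * (V i)⁻¹`, where `U` and `V` are
`m`-periodic sequences of positive words. -/
structure IsRep (m : ℕ) (U V : ℤ → List (Fin 3)) (w : FreeGroup (Fin 3)) : Prop where
  pos : 0 < m
  left_periodic : ∀ i, U (i + m) = U i
  right_periodic : ∀ i, V (i + m) = V i
  conj : IsConj w (partialProd (seg U V) m)

lemma IsRep.seg_periodic {m U V w} (h : IsRep m U V w) (i : ℤ) : seg U V (i + m) = seg U V i := by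
  rw [seg, seg, h.left_periodic, h.right_periodic]

lemma isConj_conj {G : Type*} [Group G] (g x : G) : IsConj (g * x * g⁻¹) x :=
  (isConj_iff.2 ⟨g, rfl⟩).symm

lemma IsRep.trim {m U V w} (h : IsRep m U V w) {A B U' V' : ℤ → List (Fin 3)}
    (hU : ∀ i, U i = A i ++ U' i ++ B i) (hV : ∀ i, V i = A (i + 1) ++ V' i ++ B i)
    (hA : ∀ i, A (i + m) = A i) (hU' : ∀ i, U' (i + m) = U' i) (hV' : ∀ i, V' (i + m) = V' i) :
    IsRep m U' V' w := by
  refine ⟨h.pos, hU', hV', h.conj.trans ?_⟩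
  rw [partialProd_telescope (g := fun i => posWord (A i)) (h := seg U' V')]
  · have := hA 0
    rw [zero_add] at this
    rw [this]
    exact isConj_conj _ _
  · intro i
    simp only [seg, hU i, hV i, posWord_append]
    group

lemma IsRep.shift {m U V w} (h : IsRep m U V w) (j : ℤ) :
    IsRep m (fun i => U (i + j)) (fun i => V (i + j)) w := by
  have key : ∀ f : ℤ → FreeGroup (Fin 3), (∀ i, f (i + m) = f i) →
      IsConj (partialProd f m) (partialProd (fun i => f (i + 1)) m) := by
    intro f hf
    rw [partialProd_telescope (f := f) (g := f) (h := fun i => f (i + 1)) (by simp)]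
    have := hf 0
    rw [zero_add] at this
    rw [this]
    exact isConj_conj _ _
  have hper : ∀ j i, U (i + m + j) = U (i + j) ∧ V (i + m + j) = V (i + j) := fun j i => by
    rw [add_right_comm, h.left_periodic, h.right_periodic]
    exact ⟨rfl, rfl⟩
  have hseg : ∀ j i, seg U V (i + m + j) = seg U V (i + j) := fun j i => by
    rw [add_right_comm, h.seg_periodic]
  refine ⟨h.pos, fun i => (hper j i).1, fun i => (hper j i).2, ?_⟩
  change IsConj w (partialProd (fun i => seg U V (i + j)) m)
  induction j using Int.induction_on with
  | zero => simpa using h.conj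
  | succ j ih =>
    have := ih.trans (key _ (hseg j))
    simpa only [add_assoc, add_comm, add_left_comm] using this
  | pred j ih =>
    have := key (fun i => seg U V (i + (-j - 1))) (hseg (-j - 1))
    refine ih.trans (IsConj.symm ?_)
    convert this using 3
    ring_nf

lemma IsRep.of_isConj {m : ℕ} (hm : 0 < m) {U V : ℤ → List (Fin 3)} {w}
    (h : IsConj w (partialProd (seg U V) m)) :
    IsRep m (fun i => U (i % m)) (fun i => V (i % m)) w := by
  refine ⟨hm, by simp, by simp, ?_⟩
  convert h using 1
  apply partialProd_congr
  intro i hi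
  simp only [seg]
  rw [Int.emod_eq_of_lt (by omega) (by omega)]

/-- `w` has a cyclic alternating representative with `m` pairs of segments. -/
def HasRep (m : ℕ) (w : FreeGroup (Fin 3)) : Prop := ∃ U V, IsRep m U V w

lemma HasRep.congr {m w w'} (h : HasRep m w) (hw : IsConj w' w) : HasRep m w' := by
  obtain ⟨U, V, hr⟩ := h
  exact ⟨U, V, hr.pos, hr.left_periodic, hr.right_periodic, hw.trans hr.conj⟩

lemma map_partialProd {G : Type*} [Group G] (e : MulAut G) (f : ℤ → G) (k : ℕ) :
    e (partialProd f k) = partialProd (fun i => e (f i)) k := by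
  induction k with
  | zero => simp [partialProd]
  | succ k ih => simp [partialProd, ih]

lemma isConj_map {G : Type*} [Group G] (e : MulAut G) {x y : G} (h : IsConj x y) :
    IsConj (e x) (e y) :=
  e.toMonoidHom.map_isConj h

lemma IsRep.psi {m U V w} (h : IsRep m U V w) :
    IsRep m (fun i => substWord (U i)) (fun i => substWord (V i)) (psi w) := by
  refine ⟨h.pos, fun i => by rw [h.left_periodic], fun i => by rw [h.right_periodic], ?_⟩
  convert isConj_map PhiZero.psi h.conj using 1
  rw [map_partialProd]
  congr 1
  funext i
  simp [seg, psi_posWord]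

lemma exists_hasRep {w : FreeGroup (Fin 3)} (hw : w ≠ 1) : ∃ m, HasRep m w := by
  have key : ∀ l : List (Fin 3 × Bool),
      ∃ U V, partialProd (seg U V) l.length = FreeGroup.mk l := by
    intro l
    induction l using List.reverseRecOn with
    | nil => exact ⟨fun _ => [], fun _ => [], rfl⟩
    | append_singleton l a ih =>
      obtain ⟨U, V, h⟩ := ih
      obtain ⟨u, v, huv⟩ : ∃ u v, posWord u * (posWord v)⁻¹ = FreeGroup.mk [a] := by
        obtain ⟨i, b⟩ := a
        by_cases hb : b = (i != 1)
        · exact ⟨[i], [], by simp [posWord, posLetter, hb]⟩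
        · refine ⟨[], [i], ?_⟩
          have : b = (i == 1) := by
            revert hb
            fin_cases i <;> cases b <;> decide
          simp [posWord_inv, negLetter, this]
      refine ⟨Function.update U l.length u, Function.update V l.length v, ?_⟩
      rw [List.length_append, List.length_singleton, partialProd, ← FreeGroup.mul_mk, ← h, ← huv]
      congr 1
      · apply partialProd_congr
        intro i hi
        have : (i : ℤ) ≠ l.length := by omega
        simp [seg, this]
      · simp [seg]
  obtain ⟨U, V, h⟩ := key w.toWord
  have hpos : 0 < w.toWord.length := by
    rw [List.length_pos_iff]
    simpa using hw
  rw [FreeGroup.mk_toWord] at h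
  exact ⟨_, _, _, IsRep.of_isConj hpos (U := U) (V := V) (by rw [h])⟩

lemma IsRep.merge {m U V w} (h : IsRep m U V w) (hm : 2 ≤ m) {u v : List (Fin 3)}
    (huv : posWord u * (posWord v)⁻¹ = seg U V 0 * seg U V 1) : HasRep (m - 1) w := by
  have key : ∀ k : ℕ, partialProd (seg (fun i => if i = 0 then u else U (i + 1))
      (fun i => if i = 0 then v else V (i + 1))) (k + 1) = partialProd (seg U V) (k + 2) := by
    intro k
    induction k with
    | zero =>
      simp only [partialProd]
      simpa [seg] using huv
    | succ k ih =>
      rw [partialProd, ih, partialProd.eq_def _ (k + 1 + 2)]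
      have : (k : ℤ) + 1 ≠ 0 := by omega
      simp [seg, this, add_assoc]
  obtain ⟨k, rfl⟩ := Nat.exists_eq_add_of_le' hm
  exact ⟨_, _, IsRep.of_isConj (by omega) ((key k).symm ▸ h.conj)⟩

lemma IsRep.ne_nil {m U V w} (h : IsRep m U V w) (hmin : ∀ m', HasRep m' w → m ≤ m')
    (hpos : ∀ u, ¬ IsConj w (posWord u)) (hneg : ∀ u, ¬ IsConj w (posWord u)⁻¹) (i : ℤ) :
    U i ≠ [] ∧ V i ≠ [] := by
  constructor
  · intro hU
    rcases Nat.lt_or_ge m 2 with hm | hm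
    · obtain rfl : m = 1 := by have := h.pos; omega
      exact hneg _ (by simpa [-isConj_iff, partialProd, seg, hU] using (h.shift i).conj)
    · have := (h.shift (i - 1)).merge hm (u := U (i - 1)) (v := V i ++ V (i - 1))
        (by simp [seg, hU, posWord_append, mul_assoc])
      have := hmin _ this
      omega
  · intro hV
    rcases Nat.lt_or_ge m 2 with hm | hm
    · obtain rfl : m = 1 := by have := h.pos; omega
      exact hpos _ (by simpa [-isConj_iff, partialProd, seg, hV] using (h.shift i).conj)
    · have := (h.shift i).merge hm (u := U i ++ U (i + 1)) (v := V (i + 1))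
        (by simp [seg, hV, posWord_append, mul_assoc, add_comm])
      have := hmin _ this
      omega

lemma HasRep.psi {m w} (h : HasRep m w) : HasRep m (psi w) :=
  let ⟨_, _, hr⟩ := h
  ⟨_, _, hr.psi⟩

/-- The segments are nonempty and no cancellation occurs between consecutive segments. -/
structure Tight (U V : ℤ → List (Fin 3)) : Prop where
  left_ne_nil : ∀ i, U i ≠ []
  right_ne_nil : ∀ i, V i ≠ []
  getLast_ne : ∀ i, (U i).getLast? ≠ (V i).getLast?
  head_ne : ∀ i, (V (i - 1)).head? ≠ (U i).head?

/-- The spelling of `partialProd (seg U V) k` obtained by concatenating the segments. -/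
def altWord (U V : ℤ → List (Fin 3)) : ℕ → List (Fin 3 × Bool)
  | 0 => []
  | k + 1 => altWord U V k ++ ((U k).map posLetter ++ (V k).reverse.map negLetter)

lemma mk_altWord (U V : ℤ → List (Fin 3)) (k : ℕ) :
    FreeGroup.mk (altWord U V k) = partialProd (seg U V) k := by
  induction k with
  | zero => rfl
  | succ k ih =>
    rw [altWord, partialProd, ← ih, seg, posWord_inv, posWord, FreeGroup.mul_mk, FreeGroup.mul_mk]

lemma isReduced_map_posLetter (u : List (Fin 3)) : FreeGroup.IsReduced (u.map posLetter) := by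
  rw [FreeGroup.IsReduced, List.isChain_map]
  refine List.Pairwise.isChain (List.pairwise_of_forall ?_)
  rintro i j rfl
  rfl

lemma isReduced_map_negLetter (u : List (Fin 3)) : FreeGroup.IsReduced (u.map negLetter) := by
  rw [FreeGroup.IsReduced, List.isChain_map]
  refine List.Pairwise.isChain (List.pairwise_of_forall ?_)
  rintro i j rfl
  rfl

lemma Tight.isReduced_altWord {U V} (h : Tight U V) (k : ℕ) :
    FreeGroup.IsReduced (altWord U V k) ∧
      ∀ a ∈ (altWord U V k).getLast?, ∃ i, a = negLetter i ∧ (V (k - 1)).head? = some i := by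
  induction k with
  | zero => simp [altWord]
  | succ k ih =>
    have hV : (V k).reverse ≠ [] := by simpa using h.right_ne_nil k
    have hU := h.left_ne_nil k
    refine ⟨?_, ?_⟩
    · refine List.isChain_append.2 ⟨ih.1, List.isChain_append.2
        ⟨isReduced_map_posLetter _, isReduced_map_negLetter _, ?_⟩, ?_⟩
      · intro a ha b hb
        simp only [List.getLast?_map, List.head?_map, Option.mem_def, Option.map_eq_some_iff,
          List.head?_reverse] at ha hb
        obtain ⟨i, hi, rfl⟩ := ha
        obtain ⟨j, hj, rfl⟩ := hb
        have := h.getLast_ne k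
        rw [hi, hj] at this
        intro hij
        exact absurd (congrArg some hij) this
      · intro a ha b hb
        obtain ⟨i, rfl, hi⟩ := ih.2 a ha
        have hU' : (U k).map posLetter ≠ [] := by simpa using hU
        rw [List.head?_append_of_ne_nil _ hU'] at hb
        simp only [List.head?_map, Option.mem_def, Option.map_eq_some_iff] at hb
        obtain ⟨j, hj, rfl⟩ := hb
        have := h.head_ne k
        rw [hi, hj] at this
        intro hij
        exact absurd (congrArg some hij) this
    · intro a ha
      rw [altWord, ← List.append_assoc, List.getLast?_append_of_ne_nil _ (by simpa using hV)] at ha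
      simp only [List.getLast?_map, Option.mem_def, Option.map_eq_some_iff,
        List.getLast?_reverse] at ha
      obtain ⟨i, hi, rfl⟩ := ha
      exact ⟨i, rfl, by simpa using hi⟩

lemma Tight.norm_partialProd {U V} (h : Tight U V) (k : ℕ) :
    (partialProd (seg U V) k).norm = (altWord U V k).length := by
  rw [← mk_altWord, FreeGroup.norm, FreeGroup.toWord_mk, (h.isReduced_altWord k).1.reduce_eq]

lemma norm_pow_le (w : FreeGroup (Fin 3)) (k : ℕ) : (w ^ k).norm ≤ k * w.norm := by
  induction k with
  | zero => simp
  | succ k ih =>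
    rw [pow_succ, Nat.succ_mul]
    exact (FreeGroup.norm_mul_le _ _).trans (by omega)

/-- The segments of a tight representative of `w` are no longer than `w`. -/
lemma IsRep.length_le_norm {m U V w} (h : IsRep m U V w) (ht : Tight U V) :
    (U 0).length ≤ w.norm := by
  obtain ⟨n, rfl⟩ := Nat.exists_eq_add_of_le' h.pos
  have hmono : ∀ a b : ℕ, (altWord U V a).length ≤ (altWord U V (a + b)).length := by
    intro a b
    induction b with
    | zero => rfl
    | succ b ih =>
      rw [← Nat.add_assoc, altWord, List.length_append]
      omega
  have hper : ∀ k : ℕ, U ((n + 1) * k : ℕ) = U 0 := by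
    intro k
    induction k with
    | zero => simp
    | succ k ih =>
      rw [← ih, ← h.left_periodic ((n + 1) * k : ℕ)]
      congr 1
  have hlow : ∀ k : ℕ, k * (U 0).length ≤ (altWord U V ((n + 1) * k)).length := by
    intro k
    induction k with
    | zero => simp
    | succ k ih =>
      have h1 := hmono ((n + 1) * k + 1) n
      rw [altWord, List.length_append, List.length_append, List.length_map, hper] at h1
      have e : (n + 1) * (k + 1) = (n + 1) * k + 1 + n := by ring
      rw [e, Nat.succ_mul]
      omega
  obtain ⟨g, hg⟩ := isConj_iff.1 h.conj
  have hup : ∀ k : ℕ, k * (U 0).length ≤ k * w.norm + 2 * g.norm := by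
    intro k
    refine (hlow k).trans ?_
    rw [← ht.norm_partialProd, partialProd_mul_period h.seg_periodic, ← hg, conj_pow]
    have h1 := FreeGroup.norm_mul_le (g * w ^ k) g⁻¹
    have h2 := FreeGroup.norm_mul_le g (w ^ k)
    have h3 := norm_pow_le w k
    rw [FreeGroup.norm_inv_eq] at h1
    omega
  by_contra! hlt
  have := hup (2 * g.norm + 1)
  nlinarith

lemma dropLast_append_getLast?_toList {α : Type*} (l : List α) :
    l.dropLast ++ l.getLast?.toList = l := by
  rcases List.eq_nil_or_concat l with rfl | ⟨l, a, rfl⟩ <;> simp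

lemma exists_tight {m w} (h : HasRep m w)
    (hne : ∀ U V, IsRep m U V w → ∀ i, U i ≠ [] ∧ V i ≠ []) :
    ∃ U V, IsRep m U V w ∧ Tight U V := by
  let size (U V : ℤ → List (Fin 3)) : ℕ :=
    ∑ i ∈ Finset.range m, ((U i).length + (V i).length)
  have hlt : ∀ {U V U' V' : ℤ → List (Fin 3)}, IsRep m U V w →
      (∀ i, U' (i + m) = U' i) →
      (∀ i, (U' i).length ≤ (U i).length) → (∀ i, (V' i).length ≤ (V i).length) →
      ∀ j, (U' j).length < (U j).length → size U' V' < size U V := by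
    intro U V U' V' hr hU' hUle hVle j hj
    have hm : (0 : ℤ) < m := by exact_mod_cast hr.pos
    have hmod : ∀ W : ℤ → List (Fin 3), (∀ i, W (i + m) = W i) →
        W ((j % m).toNat : ℤ) = W j := by
      intro W hW
      rw [Int.toNat_of_nonneg (Int.emod_nonneg _ hm.ne')]
      conv_rhs => rw [← Int.emod_add_mul_ediv j m, mul_comm]
      exact (Function.Periodic.int_mul hW _ _).symm
    refine Finset.sum_lt_sum (fun i _ => add_le_add (hUle i) (hVle i))
      ⟨(j % m).toNat, ?_, ?_⟩
    · have := Int.emod_lt_of_pos j hm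
      have := Int.emod_nonneg j hm.ne'
      simp only [Finset.mem_range]
      omega
    · refine add_lt_add_of_lt_of_le ?_ (hVle _)
      rw [hmod U' hU', hmod U hr.left_periodic]
      exact hj
  have hex : ∃ N U V, IsRep m U V w ∧ size U V = N :=
    let ⟨U, V, hr⟩ := h
    ⟨_, U, V, hr, rfl⟩
  classical
  obtain ⟨U, V, hr, hN⟩ := Nat.find_spec hex
  have hmin : ∀ U' V', IsRep m U' V' w → size U V ≤ size U' V' := fun U' V' hr' =>
    hN ▸ Nat.find_min' hex ⟨U', V', hr', rfl⟩
  have hUp := hr.left_periodic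
  have hVp := hr.right_periodic
  refine ⟨U, V, hr, fun i => (hne U V hr i).1, fun i => (hne U V hr i).2, fun j hj => ?_,
    fun j hj => ?_⟩
  · let c : ℤ → Prop := fun i => (U i).getLast? = (V i).getLast?
    let U' : ℤ → List (Fin 3) := fun i => if c i then (U i).dropLast else U i
    let V' : ℤ → List (Fin 3) := fun i => if c i then (V i).dropLast else V i
    have hr' : IsRep m U' V' w := by
      refine hr.trim (A := fun _ => []) (B := fun i => if c i then (U i).getLast?.toList else [])
        (fun i => ?_) (fun i => ?_) (fun _ => rfl) (fun i => ?_) (fun i => ?_)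
      · by_cases hc : c i
        · simp only [U', hc, if_true, List.nil_append]
          exact (dropLast_append_getLast?_toList _).symm
        · simp [U', hc]
      · by_cases hc : c i
        · simp only [V', hc, if_true, List.nil_append]
          rw [show (U i).getLast? = (V i).getLast? from hc]
          exact (dropLast_append_getLast?_toList _).symm
        · simp [V', hc]
      · simp only [U', c, hUp, hVp]
      · simp only [V', c, hUp, hVp]
    refine absurd (hmin _ _ hr') (not_le.2 (hlt hr hr'.left_periodic (fun i => ?_)
      (fun i => ?_) j ?_))
    · simp only [U']; split_ifs <;> simp
    · simp only [V']; split_ifs <;> simp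
    · have := List.length_pos_iff.2 (hne U V hr j).1
      simp only [U', c, hj, if_true, List.length_dropLast]
      omega
  · let c : ℤ → Prop := fun i => (V (i - 1)).head? = (U i).head?
    let U' : ℤ → List (Fin 3) := fun i => if c i then (U i).tail else U i
    let V' : ℤ → List (Fin 3) := fun i => if c (i + 1) then (V i).tail else V i
    have hVp' : ∀ i, V (i + m - 1) = V (i - 1) := fun i => by rw [add_sub_right_comm, hVp]
    have hUp' : ∀ i, U (i + m + 1) = U (i + 1) := fun i => by rw [add_right_comm, hUp]
    have hr' : IsRep m U' V' w := by
      refine hr.trim (A := fun i => if c i then (U i).head?.toList else []) (B := fun _ => [])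
        (fun i => ?_) (fun i => ?_) (fun i => ?_) (fun i => ?_) (fun i => ?_)
      · by_cases hc : c i
        · simp only [U', hc, if_true, List.append_nil]
          cases U i <;> rfl
        · simp [U', hc]
      · by_cases hc : c (i + 1)
        · simp only [V', hc, if_true, List.append_nil]
          rw [show (U (i + 1)).head? = (V i).head? by simpa [c] using hc.symm]
          cases V i <;> rfl
        · simp [V', hc]
      · simp only [c, hUp, hVp']
      · simp only [U', c, hUp, hVp']
      · simp only [V', c, hUp', hVp, add_sub_cancel_right]
    refine absurd (hmin _ _ hr') (not_le.2 (hlt hr hr'.left_periodic (fun i => ?_)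
      (fun i => ?_) j ?_))
    · simp only [U']; split_ifs <;> simp
    · simp only [V']; split_ifs <;> simp
    · have := List.length_pos_iff.2 (hne U V hr j).1
      simp only [U', c, hj, if_true, List.length_tail]
      omega

/-! ### Dynamics of the turns -/

/-- Whether the substitution creates a cancellation of one letter `y` between `V (i - 1)` and
`U i`, when these have distinct first letters. -/
def headTurn (U V : ℤ → List (Fin 3)) (i : ℤ) : Bool :=
  (V (i - 1)).head? != some 2 && (U i).head? != some 2

/-- Whether the substitution creates a cancellation of one letter `x` between `U i` and `V i`,
when these have distinct last letters. -/
def lastTurn (U V : ℤ → List (Fin 3)) (i : ℤ) : Bool :=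
  (U i).getLast? != some 1 && (V i).getLast? != some 1

/-- Remove the first letter if `p`, and the last letter if `s`. -/
def trimEnds (p s : Bool) (u : List (Fin 3)) : List (Fin 3) :=
  let t := if p then u.tail else u
  if s then t.dropLast else t

lemma substWord_eq_trimEnds {p s : Bool} {u : List (Fin 3)} (hu : u ≠ [])
    (hp : p → u.head? ≠ some 2) (hs : s → u.getLast? ≠ some 1) :
    substWord u = (if p then [1] else []) ++ trimEnds p s (substWord u) ++
      (if s then [0] else []) := by
  have hhead : u.head? ≠ some 2 → ∃ t, t ≠ [] ∧ substWord u = 1 :: t := by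
    obtain ⟨i, r, rfl⟩ := List.exists_cons_of_ne_nil hu
    intro h
    rw [substWord_cons]
    fin_cases i
    · exact ⟨0 :: substWord r, by simp, rfl⟩
    · exact ⟨2 :: substWord r, by simp, rfl⟩
    · exact absurd rfl h
  have hlast : u.getLast? ≠ some 1 → ∃ t, substWord u = t ++ [0] := by
    obtain ⟨r, i, rfl⟩ := (List.eq_nil_or_concat u).resolve_left hu
    intro h
    rw [List.concat_eq_append, substWord_append]
    fin_cases i
    · exact ⟨substWord r ++ [1], by simp [substWord, substLetter]⟩
    · simp at h
    · exact ⟨substWord r, by simp [substWord, substLetter]⟩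
  cases p <;> cases s
  · simp [trimEnds]
  · obtain ⟨t, ht⟩ := hlast (hs rfl)
    simp [trimEnds, ht]
  · obtain ⟨t, -, ht⟩ := hhead (hp rfl)
    simp [trimEnds, ht]
  · obtain ⟨t, ht0, ht⟩ := hhead (hp rfl)
    obtain ⟨t', ht'⟩ := hlast (hs rfl)
    obtain ⟨r, i, rfl⟩ := (List.eq_nil_or_concat t).resolve_left ht0
    rw [ht', List.concat_eq_append, ← List.cons_append] at ht
    obtain ⟨rfl, hi⟩ := List.append_inj' ht rfl
    rw [← hi] at ht
    simp [trimEnds, ht']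

lemma getLast?_substWord_ne (u : List (Fin 3)) : (substWord u).getLast? ≠ some 1 := by
  rcases List.eq_nil_or_concat u with rfl | ⟨r, i, rfl⟩
  · simp
  · rw [List.concat_eq_append, substWord_append]
    fin_cases i <;> simp [substWord, substLetter]

lemma head?_of_substWord_eq {p : Bool} {u u' S : List (Fin 3)} {h : Fin 3} (hh : u.head? = some h)
    (hp : p → u.head? ≠ some 2) (hu' : u' ≠ [])
    (heq : substWord u = (if p then [1] else []) ++ u' ++ S) :
    u'.head? = some (if p then (if h = 0 then 0 else 2) else (if h = 2 then 0 else 1)) := by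
  obtain ⟨r, rfl⟩ := List.head?_eq_some_iff.1 hh
  obtain ⟨k, t, rfl⟩ := List.exists_cons_of_ne_nil hu'
  rw [substWord_cons] at heq
  fin_cases h <;> cases p <;> simp_all [substLetter]
  rw [← heq.1]
  decide

lemma getLast?_of_substWord_eq {s : Bool} {u u' P : List (Fin 3)} {h : Fin 3}
    (hh : u.getLast? = some h) (hs : s → u.getLast? ≠ some 1) (hu' : u' ≠ [])
    (heq : substWord u = P ++ u' ++ (if s then [0] else [])) :
    (s = true → h = 0 → u'.getLast? = some 1) ∧ (s = true → h = 2 → u'.getLast? ≠ some 1) ∧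
      (s = false → u'.getLast? = some (if h = 0 then 0 else if h = 1 then 2 else 0)) := by
  obtain ⟨r, rfl⟩ := List.getLast?_eq_some_iff.1 hh
  have hlast : (P ++ u').getLast? = u'.getLast? := List.getLast?_append_of_ne_nil _ hu'
  have hsub : ∀ i, substWord (r ++ [i]) = substWord r ++ substLetter i := fun i => by
    simp [substWord]
  rw [hsub] at heq
  rw [← hlast]
  refine ⟨?_, ?_, ?_⟩
  · rintro rfl rfl
    rw [substLetter, show ([1, 0] : List (Fin 3)) = [1] ++ [0] from rfl, ← List.append_assoc]
      at heq
    rw [← (List.append_inj' heq rfl).1]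
    simp
  · rintro rfl rfl
    rw [← (List.append_inj' heq rfl).1]
    exact getLast?_substWord_ne r
  · rintro rfl
    simp only [Bool.false_eq_true, if_false, List.append_nil] at heq
    rw [← heq]
    fin_cases h <;> simp [substLetter]

lemma headTurn_step {h k : Fin 3} (hk : h ≠ k) {p : Bool} (hp : p = (h != 2 && k != 2)) :
    let f : Fin 3 → Fin 3 := fun h =>
      if p then (if h = 0 then 0 else 2) else (if h = 2 then 0 else 1)
    f h ≠ f k ∧ (f h != 2 && f k != 2) = !p := by
  revert h k p
  decide

lemma some_bne_some {α : Type*} [DecidableEq α] (a b : α) : (some a != some b) = (a != b) := by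
  simp [bne]

/-- The effect of `ψ` on a tight representative, as long as no segment disappears. -/
lemma IsRep.step {m U V w} (h : IsRep m U V w) (ht : Tight U V)
    (hne : ∀ U V, IsRep m U V (PhiZero.psi w) → ∀ i, U i ≠ [] ∧ V i ≠ []) :
    ∃ U' V', IsRep m U' V' (PhiZero.psi w) ∧ Tight U' V' ∧
      headTurn U' V' 0 = !headTurn U V 0 ∧ lastTurn U' V' 0 = !lastTurn U V 0 ∧
      substWord (U 0) = (if headTurn U V 0 then [1] else []) ++ U' 0 ++
        (if lastTurn U V 0 then [0] else []) := by
  let p := headTurn U V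
  let s := lastTurn U V
  let U' : ℤ → List (Fin 3) := fun i => trimEnds (p i) (s i) (substWord (U i))
  let V' : ℤ → List (Fin 3) := fun i => trimEnds (p (i + 1)) (s i) (substWord (V i))
  have hpU : ∀ i, p i → (U i).head? ≠ some 2 := fun i hi => by
    simp only [p, headTurn, Bool.and_eq_true, bne_iff_ne] at hi
    exact hi.2
  have hpV : ∀ i, p (i + 1) → (V i).head? ≠ some 2 := fun i hi => by
    simp only [p, headTurn, Bool.and_eq_true, bne_iff_ne, add_sub_cancel_right] at hi
    exact hi.1
  have hsU : ∀ i, s i → (U i).getLast? ≠ some 1 := fun i hi => by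
    simp only [s, lastTurn, Bool.and_eq_true, bne_iff_ne] at hi
    exact hi.1
  have hsV : ∀ i, s i → (V i).getLast? ≠ some 1 := fun i hi => by
    simp only [s, lastTurn, Bool.and_eq_true, bne_iff_ne] at hi
    exact hi.2
  have hU : ∀ i, substWord (U i) = (if p i then [1] else []) ++ U' i ++
      (if s i then [0] else []) :=
    fun i => substWord_eq_trimEnds (ht.left_ne_nil i) (hpU i) (hsU i)
  have hV : ∀ i, substWord (V i) = (if p (i + 1) then [1] else []) ++ V' i ++
      (if s i then [0] else []) :=
    fun i => substWord_eq_trimEnds (ht.right_ne_nil i) (hpV i) (hsV i)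
  have hp_per : ∀ i, p (i + m) = p i := fun i => by
    simp only [p, headTurn, add_sub_right_comm, h.left_periodic, h.right_periodic]
  have hs_per : ∀ i, s (i + m) = s i := fun i => by
    simp only [s, lastTurn, h.left_periodic, h.right_periodic]
  have hr : IsRep m U' V' (PhiZero.psi w) := by
    refine h.psi.trim hU hV (fun i => by rw [hp_per]) (fun i => ?_) (fun i => ?_)
    · simp only [U', hp_per, hs_per, h.left_periodic]
    · simp only [V', add_right_comm i (m : ℤ) 1, hp_per, hs_per, h.right_periodic]
  have hhead : ∀ i, (V' (i - 1)).head? ≠ (U' i).head? ∧ headTurn U' V' i = !p i := by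
    intro i
    obtain ⟨a, ha⟩ := Option.isSome_iff_exists.1 (List.isSome_head?.2 (ht.right_ne_nil (i - 1)))
    obtain ⟨b, hb⟩ := Option.isSome_iff_exists.1 (List.isSome_head?.2 (ht.left_ne_nil i))
    have hVi := hV (i - 1)
    have hpVi := hpV (i - 1)
    rw [sub_add_cancel] at hVi hpVi
    rw [List.append_assoc] at hVi
    have ha' := head?_of_substWord_eq ha hpVi (hne _ _ hr (i - 1)).2
      ((hVi.trans (List.append_assoc _ _ _).symm))
    have hb' := head?_of_substWord_eq hb (hpU i) (hne _ _ hr i).1 (hU i)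
    have hab : a ≠ b := fun hab => ht.head_ne i (by rw [ha, hb, hab])
    have := headTurn_step hab (p := p i) (by simp only [p, headTurn, ha, hb, some_bne_some])
    rw [headTurn, ha', hb', some_bne_some, some_bne_some]
    exact ⟨fun h => this.1 (Option.some_injective _ h), this.2⟩
  have hlast : ∀ i, (U' i).getLast? ≠ (V' i).getLast? ∧ lastTurn U' V' i = !s i := by
    intro i
    obtain ⟨a, ha⟩ := Option.isSome_iff_exists.1 (List.getLast?_isSome.2 (ht.left_ne_nil i))
    obtain ⟨b, hb⟩ := Option.isSome_iff_exists.1 (List.getLast?_isSome.2 (ht.right_ne_nil i))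
    have ha' := getLast?_of_substWord_eq ha (hsU i) (hne _ _ hr i).1 (hU i)
    have hb' := getLast?_of_substWord_eq hb (hsV i) (hne _ _ hr i).2 (hV i)
    have hab : a ≠ b := fun hab => ht.getLast_ne i (by rw [ha, hb, hab])
    have hs : s i = (a != 1 && b != 1) := by
      simp only [s, lastTurn, ha, hb, some_bne_some]
    rw [lastTurn]
    rw [hs] at ha' hb' ⊢
    generalize (U' i).getLast? = x at *
    generalize (V' i).getLast? = y at *
    clear * - ha' hb' hab
    fin_cases a <;> fin_cases b <;> simp_all [Ne.symm]
  exact ⟨U', V', hr, ⟨fun i => (hne _ _ hr i).1, fun i => (hne _ _ hr i).2,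
    fun i => (hlast i).1, fun i => (hhead i).1⟩, (hhead 0).2, (hlast 0).2, hU 0⟩

/-! ### The eigenvector of the substitution -/

lemma exists_plastic : ∃ ρ : ℝ, 1.3247 < ρ ∧ ρ < 1.3248 ∧ ρ ^ 3 = ρ + 1 := by
  have hc : ContinuousOn (fun x : ℝ => x ^ 3 - x - 1) (Set.Icc 1.3247 1.3248) := by fun_prop
  obtain ⟨ρ, ⟨h1, h2⟩, h3⟩ := intermediate_value_Ioo (by norm_num) hc
    (show (0 : ℝ) ∈ _ by constructor <;> norm_num)
  exact ⟨ρ, h1, h2, by linarith [h3]⟩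

/-- The weights `ρ², ρ, 1` of `x, y, z`. -/
def letterWeight (ρ : ℝ) : Fin 3 → ℝ
  | 0 => ρ ^ 2
  | 1 => ρ
  | 2 => 1

/-- The total weight of a positive word. -/
noncomputable def weight (ρ : ℝ) (u : List (Fin 3)) : ℝ := (u.map (letterWeight ρ)).sum

lemma weight_append (ρ : ℝ) (u v : List (Fin 3)) :
    weight ρ (u ++ v) = weight ρ u + weight ρ v := by simp [weight]

lemma weight_cons (ρ : ℝ) (i : Fin 3) (u : List (Fin 3)) :
    weight ρ (i :: u) = letterWeight ρ i + weight ρ u := by simp [weight]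

lemma weight_substWord {ρ : ℝ} (hρ : ρ ^ 3 = ρ + 1) (u : List (Fin 3)) :
    weight ρ (substWord u) = ρ ^ 2 * weight ρ u := by
  induction u with
  | nil => simp [weight]
  | cons i u ih =>
    rw [substWord_cons, weight_append, weight_cons, ih]
    fin_cases i
    · simp [weight, substLetter, letterWeight]; linear_combination -ρ * hρ
    · simp [weight, substLetter, letterWeight]; linear_combination -hρ
    · simp [weight, substLetter, letterWeight]; ring

lemma letterWeight_pos {ρ : ℝ} (hρ : 0 < ρ) (i : Fin 3) : 0 < letterWeight ρ i := by
  fin_cases i <;> simp [letterWeight, hρ]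

lemma weight_nonneg {ρ : ℝ} (hρ : 0 < ρ) (u : List (Fin 3)) : 0 ≤ weight ρ u := by
  induction u with
  | nil => simp [weight]
  | cons i u ih =>
    rw [weight_cons]
    exact add_nonneg (letterWeight_pos hρ i).le ih

lemma weight_le {ρ : ℝ} (hρ : 1 ≤ ρ) (u : List (Fin 3)) : weight ρ u ≤ u.length * ρ ^ 2 := by
  induction u with
  | nil => simp [weight]
  | cons i u ih =>
    have : letterWeight ρ i ≤ ρ ^ 2 := by
      fin_cases i <;> simp only [letterWeight] <;> nlinarith
    rw [weight_cons, List.length_cons]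
    push_cast
    linarith

lemma exists_weight_eq (ρ : ℝ) (u : List (Fin 3)) :
    ∃ a b c : ℕ, weight ρ u = a * ρ ^ 2 + b * ρ + c := by
  induction u with
  | nil => exact ⟨0, 0, 0, by simp [weight]⟩
  | cons i u ih =>
    obtain ⟨a, b, c, h⟩ := ih
    rw [weight_cons, h]
    fin_cases i
    · exact ⟨a + 1, b, c, by simp [letterWeight]; ring⟩
    · exact ⟨a, b + 1, c, by simp [letterWeight]; ring⟩
    · exact ⟨a, b, c + 1, by simp [letterWeight]; ring⟩

/-- The weight of a segment whose ends, of the given types, cancel exactly as fast as the segment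
grows. -/
noncomputable def criticalWeight (ρ : ℝ) (p s : Bool) : ℝ :=
  ((if p then ρ ^ 3 else ρ) + (if s then ρ ^ 4 else ρ ^ 2)) / (ρ ^ 4 - 1)

lemma criticalWeight_step {ρ : ℝ} (hρ : 1 < ρ) (p s : Bool) :
    ρ ^ 2 * criticalWeight ρ p s =
      (if p then ρ else 0) + criticalWeight ρ (!p) (!s) + (if s then ρ ^ 2 else 0) := by
  have : ρ ^ 4 - 1 ≠ 0 := (sub_pos.2 (one_lt_pow₀ hρ (by norm_num))).ne'
  simp only [criticalWeight]
  field_simp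
  cases p <;> cases s <;> simp <;> ring

lemma weight_ne_criticalWeight {ρ : ℝ} (h1 : 1.3247 < ρ) (h2 : ρ < 1.3248) (h3 : ρ ^ 3 = ρ + 1)
    (u : List (Fin 3)) (p s : Bool) : weight ρ u ≠ criticalWeight ρ p s := by
  obtain ⟨a, b, c, h⟩ := exists_weight_eq ρ u
  have hsq : 1.7548 < ρ ^ 2 := by nlinarith
  have hsq' : ρ ^ 2 < 1.7551 := by nlinarith
  have h4 : ρ ^ 4 = ρ ^ 2 + ρ := by linear_combination ρ * h3
  have hd : 0 < ρ ^ 4 - 1 := by linarith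
  rw [h]
  intro hc
  rw [criticalWeight, eq_div_iff hd.ne', h3, h4] at hc
  have hbound : ∀ x : ℝ, x * (ρ ^ 2 + ρ - 1) =
      (if p then ρ + 1 else ρ) + (if s then ρ ^ 2 + ρ else ρ ^ 2) →
      (p = true → s = true → 2.5 < x ∧ x < 2.6) ∧ (p = true → s = false → 1.95 < x ∧ x < 1.97) ∧
      (p = false → s = true → 2.1 < x ∧ x < 2.13) ∧
      (p = false → s = false → 1.47 < x ∧ x < 1.49) := by
    intro x hx
    refine ⟨?_, ?_, ?_, ?_⟩ <;> rintro rfl rfl <;> simp at hx <;> constructor <;> nlinarith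
  have hb := hbound _ hc
  have hlt : (a : ℝ) * ρ ^ 2 + b * ρ + c < 2.6 := by
    cases p <;> cases s <;> simp at hb <;> linarith
  have ha : (a : ℝ) * 1.7548 ≤ a * ρ ^ 2 := by gcongr
  have hb' : (b : ℝ) * 1.3247 ≤ b * ρ := by gcongr
  have ha0 := Nat.cast_nonneg (α := ℝ) a
  have hb0 := Nat.cast_nonneg (α := ℝ) b
  have hc0 := Nat.cast_nonneg (α := ℝ) c
  have ha2 : a < 2 := by
    have : (a : ℝ) < 2 := by linarith
    exact_mod_cast this
  have hb2 : b < 2 := by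
    have : (b : ℝ) < 2 := by linarith
    exact_mod_cast this
  have hc3 : c < 3 := by
    have : (c : ℝ) < 3 := by linarith
    exact_mod_cast this
  clear hbound hc
  interval_cases a <;> interval_cases b <;> interval_cases c <;> cases p <;> cases s <;>
    simp at hb <;> linarith

/-- The homomorphism to `ℝ` extending `weight`. -/
noncomputable def weightHom (ρ : ℝ) : FreeGroup (Fin 3) →* Multiplicative ℝ :=
  FreeGroup.lift fun i => Multiplicative.ofAdd (if i = 1 then -ρ else letterWeight ρ i)

lemma weightHom_posWord (ρ : ℝ) (u : List (Fin 3)) :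
    weightHom ρ (posWord u) = Multiplicative.ofAdd (weight ρ u) := by
  induction u with
  | nil => rfl
  | cons i u ih =>
    rw [posWord_cons, map_mul, ih, weight_cons, ofAdd_add]
    congr 1
    fin_cases i <;> simp [posWord, posLetter, weightHom, letterWeight]

lemma weightHom_psi {ρ : ℝ} (hρ : ρ ^ 3 = ρ + 1) (w : FreeGroup (Fin 3)) :
    (weightHom ρ (psi w)).toAdd = ρ ^ 2 * (weightHom ρ w).toAdd := by
  have hpos : ∀ i, (weightHom ρ (psi (posWord [i]))).toAdd =
      ρ ^ 2 * (weightHom ρ (posWord [i])).toAdd := fun i => by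
    rw [psi_posWord, weightHom_posWord, weightHom_posWord, toAdd_ofAdd, toAdd_ofAdd,
      weight_substWord hρ]
  have hinv : ∀ x, (weightHom ρ (psi x)).toAdd = ρ ^ 2 * (weightHom ρ x).toAdd →
      (weightHom ρ (psi x⁻¹)).toAdd = ρ ^ 2 * (weightHom ρ x⁻¹).toAdd := fun x hx => by
    simp [hx]
  have hof : ∀ i, (weightHom ρ (psi (FreeGroup.of i))).toAdd =
      ρ ^ 2 * (weightHom ρ (FreeGroup.of i)).toAdd := by
    intro i
    fin_cases i
    · exact hpos 0
    · simpa [posWord, posLetter, FreeGroup.inv_mk, FreeGroup.invRev, FreeGroup.of]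
        using hinv _ (hpos 1)
    · exact hpos 2
  induction w using FreeGroup.induction_on with
  | C1 => simp
  | of i => exact hof i
  | inv_of i h => exact hinv _ (hof i)
  | mul x y hx hy => simp [hx, hy, mul_add]

lemma weightHom_psi_pow {ρ : ℝ} (hρ : ρ ^ 3 = ρ + 1) (w : FreeGroup (Fin 3)) (n : ℕ) :
    (weightHom ρ ((psi ^ n) w)).toAdd = (ρ ^ 2) ^ n * (weightHom ρ w).toAdd := by
  induction n with
  | zero => simp
  | succ n ih => rw [pow_succ', MulAut.mul_apply, weightHom_psi hρ, ih]; ring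

/-! ### Periodic conjugacy classes -/

lemma weight_eq_zero_iff {ρ : ℝ} (hρ : 0 < ρ) {u : List (Fin 3)} : weight ρ u = 0 ↔ u = [] := by
  refine ⟨fun h => ?_, fun h => by simp [h, weight]⟩
  cases u with
  | nil => rfl
  | cons i u =>
    rw [weight_cons] at h
    have := letterWeight_pos hρ i
    have := weight_nonneg hρ u
    linarith

lemma not_isConj_posWord {w : FreeGroup (Fin 3)} (hw : w ≠ 1) {n : ℕ} (hn : 1 ≤ n)
    (h : IsConj w ((psi ^ n) w)) (u : List (Fin 3)) :
    ¬ IsConj w (posWord u) ∧ ¬ IsConj w (posWord u)⁻¹ := by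
  obtain ⟨ρ, h1, -, hρ⟩ := exists_plastic
  have hρ1 : 1 < ρ := by linarith
  have hpow : 1 < (ρ ^ 2) ^ n := one_lt_pow₀ (one_lt_pow₀ hρ1 two_ne_zero) (by omega)
  have hzero : (weightHom ρ w).toAdd = 0 := by
    have h2 := congrArg Multiplicative.toAdd (isConj_iff_eq.1 ((weightHom ρ).map_isConj h))
    rw [weightHom_psi_pow hρ] at h2
    have h3 : ((ρ ^ 2) ^ n - 1) * (weightHom ρ w).toAdd = 0 := by linarith
    exact (mul_eq_zero.1 h3).resolve_left (by linarith)
  constructor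
  · intro hu
    have h2 := congrArg Multiplicative.toAdd (isConj_iff_eq.1 ((weightHom ρ).map_isConj hu))
    rw [hzero, weightHom_posWord, toAdd_ofAdd, eq_comm, weight_eq_zero_iff (by linarith)] at h2
    rw [h2] at hu
    exact hw (isConj_one_left.1 hu)
  · intro hu
    have h2 := congrArg Multiplicative.toAdd (isConj_iff_eq.1 ((weightHom ρ).map_isConj hu))
    rw [hzero, map_inv, weightHom_posWord, toAdd_inv, toAdd_ofAdd, eq_comm, neg_eq_zero,
      weight_eq_zero_iff (by linarith)] at h2
    rw [h2, posWord_nil, inv_one] at hu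
    exact hw (isConj_one_left.1 hu)

lemma isConj_pow_mul {G : Type*} [Group G] {e : MulAut G} {x : G} {n : ℕ}
    (h : IsConj x ((e ^ n) x)) (k : ℕ) : IsConj x ((e ^ (n * k)) x) := by
  induction k with
  | zero => exact IsConj.refl x
  | succ k ih =>
    rw [Nat.mul_succ, pow_add, MulAut.mul_apply]
    exact ih.trans (isConj_map _ h)

lemma hasRep_psi_pow {m w} (h : HasRep m w) (k : ℕ) : HasRep m ((psi ^ k) w) := by
  induction k with
  | zero => simpa using h
  | succ k ih =>
    rw [pow_succ', MulAut.mul_apply]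
    exact ih.psi

lemma atoroidal_psi : Atoroidal psi := by
  intro n hn w hw hconj
  classical
  have hex := exists_hasRep hw
  obtain ⟨m, hm, hmin⟩ : ∃ m, HasRep m w ∧ ∀ m', HasRep m' w → m ≤ m' :=
    ⟨Nat.find hex, Nat.find_spec hex, fun _ h => Nat.find_min' hex h⟩
  have hne : ∀ k U V, IsRep m U V ((psi ^ k) w) → ∀ i, U i ≠ [] ∧ V i ≠ [] := by
    intro k U V hr
    have hw' : (psi ^ k) w ≠ 1 := by simpa using hw
    have hconj' : IsConj ((psi ^ k) w) ((psi ^ n) ((psi ^ k) w)) := by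
      rw [← MulAut.mul_apply, ← pow_add, add_comm, pow_add, MulAut.mul_apply]
      exact isConj_map _ hconj
    have hnot := not_isConj_posWord hw' hn hconj'
    refine hr.ne_nil (fun m' hm' => hmin m' ?_) (fun u => (hnot u).1) (fun u => (hnot u).2)
    have hle : k ≤ n * k := Nat.le_mul_of_pos_left k hn
    have := hasRep_psi_pow hm' (n * k - k)
    rw [← MulAut.mul_apply, ← pow_add, Nat.sub_add_cancel hle] at this
    exact this.congr (isConj_pow_mul hconj k)
  obtain ⟨ρ, h1, h2, hρ⟩ := exists_plastic
  have hρ1 : 1 < ρ := by linarith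
  obtain ⟨U₀, V₀, hr₀, ht₀⟩ := exists_tight hm (fun U V hr => hne 0 U V (by simpa using hr))
  let D (U V : ℤ → List (Fin 3)) : ℝ :=
    weight ρ (U 0) - criticalWeight ρ (headTurn U V 0) (lastTurn U V 0)
  have hgrow : ∀ k, ∃ U V, IsRep m U V ((psi ^ k) w) ∧ Tight U V ∧
      D U V = (ρ ^ 2) ^ k * D U₀ V₀ := by
    intro k
    induction k with
    | zero => exact ⟨U₀, V₀, by simpa using hr₀, ht₀, by simp⟩
    | succ k ih =>
      obtain ⟨U, V, hr, ht, hD⟩ := ih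
      have hs : psi ((psi ^ k) w) = (psi ^ (k + 1)) w := by rw [pow_succ', MulAut.mul_apply]
      obtain ⟨U', V', hr', ht', hp, hs', hU⟩ :=
        hr.step ht (fun U V h => hne (k + 1) U V (hs ▸ h))
      refine ⟨U', V', hs ▸ hr', ht', ?_⟩
      have hwt := congrArg (weight ρ) hU
      rw [weight_substWord hρ, weight_append, weight_append] at hwt
      have hc := criticalWeight_step hρ1 (headTurn U V 0) (lastTurn U V 0)
      have e1 : weight ρ (if headTurn U V 0 then [1] else []) =
          if headTurn U V 0 then ρ else 0 := by split_ifs <;> simp [weight, letterWeight]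
      have e2 : weight ρ (if lastTurn U V 0 then [0] else []) =
          if lastTurn U V 0 then ρ ^ 2 else 0 := by split_ifs <;> simp [weight, letterWeight]
      rw [e1, e2] at hwt
      rw [pow_succ', mul_assoc, ← hD]
      simp only [D, hp, hs']
      linarith
  have hD₀ : D U₀ V₀ ≠ 0 := sub_ne_zero.2 (weight_ne_criticalWeight h1 h2 hρ _ _ _)
  obtain ⟨C, hC⟩ : ∃ C : ℝ, ∀ p s, |criticalWeight ρ p s| ≤ C :=
    ⟨∑ p, ∑ s, |criticalWeight ρ p s|, fun p s =>
      (Finset.single_le_sum (f := fun s => |criticalWeight ρ p s|) (fun _ _ => abs_nonneg _)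
        (Finset.mem_univ s)).trans
      (Finset.single_le_sum (f := fun p => ∑ s, |criticalWeight ρ p s|)
        (fun _ _ => Finset.sum_nonneg fun _ _ => abs_nonneg _) (Finset.mem_univ p))⟩
  have hbound : ∀ k : ℕ, (ρ ^ 2) ^ k * |D U₀ V₀| ≤ w.norm * ρ ^ 2 + C := by
    intro k
    obtain ⟨U, V, hr, ht, hD⟩ := hgrow (n * k)
    have hr' : IsRep m U V w :=
      ⟨hr.pos, hr.left_periodic, hr.right_periodic, (isConj_pow_mul hconj k).trans hr.conj⟩
    have hlen : ((U 0).length : ℝ) * ρ ^ 2 ≤ w.norm * ρ ^ 2 := by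
      gcongr
      exact hr'.length_le_norm ht
    have hw1 := weight_le hρ1.le (U 0)
    have hw0 := weight_nonneg (by linarith : 0 < ρ) (U 0)
    calc (ρ ^ 2) ^ k * |D U₀ V₀| ≤ (ρ ^ 2) ^ (n * k) * |D U₀ V₀| := by
          gcongr
          · exact (one_lt_pow₀ hρ1 two_ne_zero).le
          · exact Nat.le_mul_of_pos_left k hn
      _ = |D U V| := by rw [hD, abs_mul, abs_of_nonneg (pow_nonneg (sq_nonneg ρ) _)]
      _ ≤ |weight ρ (U 0)| + |criticalWeight ρ (headTurn U V 0) (lastTurn U V 0)| :=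
          abs_sub _ _
      _ ≤ w.norm * ρ ^ 2 + C := by
          rw [abs_of_nonneg hw0]
          exact add_le_add (hw1.trans hlen) (hC _ _)
  obtain ⟨k, hk⟩ := pow_unbounded_of_one_lt ((w.norm * ρ ^ 2 + C) / |D U₀ V₀|)
    (one_lt_pow₀ hρ1 two_ne_zero)
  rw [div_lt_iff₀ (abs_pos.2 hD₀)] at hk
  exact absurd (hbound k) (not_le.2 hk)

end PhiZero

/-- The automorphism `φ₀` is atoroidal. -/
theorem phi0_atoroidal : Atoroidal phi0 := by
  intro n hn w hw h
  have hinv : IsConj w ((phi0⁻¹ ^ n) w) := by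
    have := PhiZero.isConj_map (phi0⁻¹ ^ n) h
    rw [← MulAut.mul_apply, inv_pow, inv_mul_cancel, MulAut.one_apply, ← inv_pow] at this
    exact this.symm
  refine PhiZero.atoroidal_psi n hn w hw ?_
  rw [PhiZero.psi, ← pow_mul, mul_comm]
  exact PhiZero.isConj_pow_mul hinv 2
end

section
/- Let r be a natural number and let φ and ψ be automorphisms of the free group F_r. Suppose the free-by-cyclic group G = F_r ⋊_φ ℤ has first Betti number 1. If G is isomorphic to F_r ⋊_ψ ℤ, then φ and ψ represent conjugate elements of Out(F_r), or φ and ψ⁻¹ represent conjugate elements of Out(F_r). -/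
/-- A homomorphism to `ℤ` that vanishes at an element mapped to `1` by another one is trivial,
if the group has first Betti number 1. -/
theorem FirstBettiOne.eq_one_of_apply_eq_one {G : Type*} [Group G] (hb : FirstBettiOne G)
    (p d : G →* Multiplicative ℤ) (t : G) (hp : p t = Multiplicative.ofAdd 1) (hd : d t = 1) :
    d = 1 := by
  obtain ⟨k, hk⟩ := Int.subgroup_cyclic (MonoidHom.toAdditiveLeft d).range
  have hmem (n : ℤ) : (∃ x, (d x).toAdd = n) ↔ k ∣ n := by
    have h : n ∈ (MonoidHom.toAdditiveLeft d).range ↔ k ∣ n := by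
      rw [hk, ← AddSubgroup.zmultiples_eq_closure, Int.mem_zmultiples_iff]
    rw [← h]
    rfl
  have hdvd (x : G) : k ∣ (d x).toAdd := (hmem _).1 ⟨x, rfl⟩
  by_cases hk0 : k = 0
  · ext x
    simpa [hk0] using hdvd x
  refine absurd ?_ hb.2
  refine ⟨{ toFun := fun x ↦ Multiplicative.ofAdd ((p x).toAdd, (d x).toAdd / k)
            map_one' := by simp
            map_mul' := fun x y ↦ by
              simp [Int.add_ediv_of_dvd_left (hdvd x), ← ofAdd_add] }, fun y ↦ ?_⟩
  obtain ⟨u, hu⟩ := (hmem k).2 dvd_rfl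
  refine ⟨u ^ y.toAdd.2 * t ^ (y.toAdd.1 - y.toAdd.2 * (p u).toAdd), ?_⟩
  apply Multiplicative.toAdd.injective
  ext <;> simp [hp, hd, hu, hk0]

/-- Any two surjections to `ℤ` from a group with first Betti number 1 agree up to sign. -/
theorem FirstBettiOne.eq_zpow_of_surjective {G : Type*} [Group G] (hb : FirstBettiOne G)
    (p q : G →* Multiplicative ℤ) (hp : Function.Surjective p) (hq : Function.Surjective q) :
    ∃ m : ℤ, IsUnit m ∧ ∀ x, q x = p x ^ m := by
  obtain ⟨t, ht⟩ := hp (Multiplicative.ofAdd 1)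
  have hd := hb.eq_one_of_apply_eq_one p (q / p ^ (q t).toAdd) t ht <| by
    apply Multiplicative.toAdd.injective
    simp [ht]
  have hqp (x : G) : q x = p x ^ (q t).toAdd := by
    simpa [div_eq_one] using DFunLike.congr_fun hd x
  refine ⟨(q t).toAdd, ?_, hqp⟩
  obtain ⟨s, hs⟩ := hq (Multiplicative.ofAdd 1)
  refine .of_mul_eq_one (p s).toAdd ?_
  simpa [hs] using (congrArg Multiplicative.toAdd (hqp s)).symm

/-- An isomorphism of free-by-cyclic groups that multiplies the projections to `ℤ` by a unit `m`
conjugates `φ` to `ψ ^ m` in the outer automorphism group. -/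
theorem OutConj.of_mulEquiv {r : ℕ} {φ ψ : MulAut (FreeGroup (Fin r))}
    (e : FreeByCyclic φ ≃* FreeByCyclic ψ) (m : ℤ) (hm : IsUnit m)
    (h : ∀ x, (e x).right = x.right ^ m) : OutConj φ (ψ ^ m) := by
  have hsymm (y : FreeByCyclic ψ) (hy : y.right = 1) : (e.symm y).right = 1 := by
    have := h (e.symm y)
    rw [e.apply_symm_apply, hy] at this
    have := congrArg Multiplicative.toAdd this
    simpa [hm.ne_zero] using this
  have inl_left {χ : MulAut (FreeGroup (Fin r))} (y : FreeByCyclic χ) (hy : y.right = 1) :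
      SemidirectProduct.inl y.left = y := by
    ext <;> simp [hy]
  let σ : MulAut (FreeGroup (Fin r)) :=
    { toFun := fun x ↦ (e (SemidirectProduct.inl x)).left
      invFun := fun x ↦ (e.symm (SemidirectProduct.inl x)).left
      left_inv := fun x ↦ by simp [inl_left _ (show (e (.inl x)).right = 1 by simp [h])]
      right_inv := fun x ↦ by simp [inl_left _ (hsymm (.inl x) (by simp))]
      map_mul' := fun x y ↦ by simp [h] }
  have hσ (x : FreeGroup (Fin r)) : e (.inl x) = .inl (σ x) :=
    (inl_left _ (show (e (.inl x)).right = 1 by simp [h])).symm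
  set t : FreeByCyclic φ := .inr (Multiplicative.ofAdd 1) with ht
  have htr : (e t).right = Multiplicative.ofAdd m := by
    rw [h]
    apply Multiplicative.toAdd.injective
    simp [ht]
  have key (x : FreeGroup (Fin r)) :
      (e t).left * (ψ ^ m) (σ x) = σ (φ x) * (e t).left := by
    have hrel : t * .inl x = .inl (φ x) * t := by
      ext <;> simp [ht]
    have := congrArg (fun y ↦ (e y).left) hrel
    simpa [hσ, htr] using this
  refine ⟨σ, (e t).left⁻¹, fun x ↦ ?_⟩
  have := key (σ.symm x)
  rw [MulEquiv.apply_symm_apply] at this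
  rw [inv_inv, mul_assoc, ← this, inv_mul_cancel_left]

/-- If `b₁(F_r ⋊_φ ℤ) = 1` and `F_r ⋊_φ ℤ ≅ F_r ⋊_ψ ℤ`, then `φ` and
`ψ`, or `φ` and `ψ⁻¹`, represent conjugate elements of `Out(F_r)`. -/
theorem iso_imp_outConj (r : ℕ) (φ ψ : MulAut (FreeGroup (Fin r)))
    (hb : FirstBettiOne (FreeByCyclic φ))
    (h : Nonempty (FreeByCyclic φ ≃* FreeByCyclic ψ)) :
    OutConj φ ψ ∨ OutConj φ ψ⁻¹ := by
  obtain ⟨e⟩ := h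
  obtain ⟨m, hm, hqp⟩ := hb.eq_zpow_of_surjective SemidirectProduct.rightHom
    (SemidirectProduct.rightHom.comp e.toMonoidHom) SemidirectProduct.rightHom_surjective
    (SemidirectProduct.rightHom_surjective.comp e.surjective)
  have hconj := OutConj.of_mulEquiv e m hm hqp
  rcases Int.isUnit_iff.1 hm with rfl | rfl
  · exact .inl (by simpa using hconj)
  · exact .inr (by simpa using hconj)
end

section
/- Let r, s be natural numbers, let φ be an atoroidal automorphism of the free group F_r, and suppose the free-by-cyclic group G = F_r ⋊_φ ℤ has first Betti number 1. If ψ is an automorphism of F_s such that H = F_s ⋊_ψ ℤ has the same finite quotients as G, then r = s. -/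
/-- The stable letter of the semidirect product. -/
def FreeByCyclic.stable {r : ℕ} (φ : MulAut (FreeGroup (Fin r))) : FreeByCyclic φ :=
  SemidirectProduct.inr (Multiplicative.ofAdd 1)

/-- The exponent matrix of an automorphism of a free group minus the identity, with rows indexed
by the generators. -/
def coinvariantMatrix {r : ℕ} (φ : MulAut (FreeGroup (Fin r))) : Matrix (Fin r) (Fin r) ℤ :=
  Matrix.of fun i j => (FreeGroup.lift (fun k => Multiplicative.ofAdd (Pi.single k (1 : ℤ)))
    (φ (FreeGroup.of i)) : Multiplicative (Fin r → ℤ)).toAdd j - (1 : Matrix (Fin r) (Fin r) ℤ) i j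

/-- A homomorphism from a free group to an abelian group is computed from exponent sums. -/
theorem FreeGroup.hom_eq_sum_exponents {r : ℕ} {A : Type*} [AddCommGroup A]
    (g : FreeGroup (Fin r) →* Multiplicative A) (w : FreeGroup (Fin r)) :
    (g w).toAdd = ∑ j, (FreeGroup.lift (fun k => Multiplicative.ofAdd (Pi.single k (1 : ℤ))) w :
      Multiplicative (Fin r → ℤ)).toAdd j • (g (FreeGroup.of j)).toAdd := by
  induction w using FreeGroup.induction_on with
  | C1 => simp
  | of i => simp [Pi.single_apply, ite_smul]
  | inv_of i _ => simp [Pi.single_apply, ite_smul]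
  | mul x y hx hy => simp [hx, hy, add_smul, Finset.sum_add_distrib]

theorem coinvariantMatrix_sum_smul {r : ℕ} {A : Type*} [AddCommGroup A]
    (φ : MulAut (FreeGroup (Fin r))) (g : FreeGroup (Fin r) →* Multiplicative A) (i : Fin r) :
    ∑ j, coinvariantMatrix φ i j • (g (FreeGroup.of j)).toAdd =
      (g (φ (FreeGroup.of i))).toAdd - (g (FreeGroup.of i)).toAdd := by
  rw [FreeGroup.hom_eq_sum_exponents g (φ _)]
  simp [coinvariantMatrix, sub_smul, Finset.sum_sub_distrib, Matrix.one_apply, ite_smul]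

theorem map_zpow_apply_of_semiconj {N M : Type*} [Group N] [Group M] {f : N →* M} {φ : MulAut N}
    {α : MulAut M} (h : ∀ w, f (φ w) = α (f w)) (n : ℤ) (w : N) :
    f ((φ ^ n) w) = (α ^ n) (f w) := by
  induction n generalizing w with
  | zero => simp
  | succ n ih => rw [zpow_add_one, zpow_add_one, MulAut.mul_apply, MulAut.mul_apply, ih, h]
  | pred n ih =>
    have h' : f (φ⁻¹ w) = α⁻¹ (f w) := by
      apply α.injective
      rw [← h, MulAut.apply_inv_self, MulAut.apply_inv_self]
    rw [zpow_sub_one, zpow_sub_one, MulAut.mul_apply, MulAut.mul_apply, ih, h']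

namespace FreeByCyclic

theorem inl_apply_eq_conj {r : ℕ} (φ : MulAut (FreeGroup (Fin r))) (w : FreeGroup (Fin r)) :
    (SemidirectProduct.inl (φ w) : FreeByCyclic φ) =
      stable φ * SemidirectProduct.inl w * (stable φ)⁻¹ := by
  have := SemidirectProduct.inl_aut (φ := zpowersHom (MulAut (FreeGroup (Fin r))) φ)
    (Multiplicative.ofAdd 1) w
  simpa [stable] using this

theorem eq_inl_mul_stable_zpow {r : ℕ} (φ : MulAut (FreeGroup (Fin r))) (x : FreeByCyclic φ) :
    x = SemidirectProduct.inl x.left * stable φ ^ x.right.toAdd := by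
  conv_lhs => rw [← SemidirectProduct.inl_left_mul_inr_right x]
  rw [stable, ← map_zpow, ← ofAdd_zsmul]
  simp

/-- The coinvariant determinant annihilates the image of the fibre in the abelianization. -/
theorem inl_pow_mem_commutator {r : ℕ} (φ : MulAut (FreeGroup (Fin r))) (w : FreeGroup (Fin r)) :
    (SemidirectProduct.inl w : FreeByCyclic φ) ^ (coinvariantMatrix φ).det.natAbs ∈
      commutator (FreeByCyclic φ) := by
  let g : FreeGroup (Fin r) →* Multiplicative (Additive (Abelianization (FreeByCyclic φ))) :=
    MulEquiv.toMultiplicative_toAdditive.symm.toMonoidHom.comp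
      (Abelianization.of.comp SemidirectProduct.inl)
  have hg : ∀ x, g (φ x) = g x := fun x => by
    change Abelianization.of (SemidirectProduct.inl (φ x) : FreeByCyclic φ) =
      Abelianization.of (SemidirectProduct.inl x)
    simp only [inl_apply_eq_conj, map_mul, map_inv, mul_inv_cancel_comm]
  have hM : ∀ i, ∑ j, coinvariantMatrix φ i j • (g (FreeGroup.of j)).toAdd = 0 := fun i => by
    rw [coinvariantMatrix_sum_smul, hg, sub_self]
  have hdet : ∀ k, (coinvariantMatrix φ).det • (g (FreeGroup.of k)).toAdd = 0 := fun k => by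
    calc (coinvariantMatrix φ).det • (g (FreeGroup.of k)).toAdd
        = ∑ j, ((coinvariantMatrix φ).adjugate * coinvariantMatrix φ) k j •
            (g (FreeGroup.of j)).toAdd := by
          simp [Matrix.adjugate_mul, Matrix.smul_apply, Matrix.one_apply, ite_smul]
      _ = ∑ i, (coinvariantMatrix φ).adjugate k i •
            ∑ j, coinvariantMatrix φ i j • (g (FreeGroup.of j)).toAdd := by
          simp only [Matrix.mul_apply, Finset.sum_smul, Finset.smul_sum, mul_smul]
          exact Finset.sum_comm
      _ = 0 := by simp [hM]
  have hw : (coinvariantMatrix φ).det • (g w).toAdd = 0 := by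
    rw [FreeGroup.hom_eq_sum_exponents g w, Finset.smul_sum]
    exact Finset.sum_eq_zero fun j _ => by rw [smul_comm, hdet, smul_zero]
  have hw' : (coinvariantMatrix φ).det.natAbs • (g w).toAdd = 0 := by
    rcases Int.natAbs_eq (coinvariantMatrix φ).det with h | h <;>
      rw [h] at hw <;> simpa using hw
  rw [← Abelianization.ker_of, MonoidHom.mem_ker, map_pow]
  exact hw'

/-- If the first Betti number is at most 1, the coinvariant matrix is nonsingular. -/
theorem det_coinvariantMatrix_ne_zero {r : ℕ} (φ : MulAut (FreeGroup (Fin r)))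
    (h : ¬ ∃ f : FreeByCyclic φ →* Multiplicative (ℤ × ℤ), Function.Surjective f) :
    (coinvariantMatrix φ).det ≠ 0 := by
  intro hdet
  obtain ⟨v, hv, hMv⟩ := Matrix.exists_mulVec_eq_zero_iff.mpr hdet
  obtain ⟨i₀, hi₀⟩ := Function.ne_iff.mp hv
  obtain ⟨u, hvu, hu⟩ := Finset.univ.extract_gcd v ⟨i₀, Finset.mem_univ i₀⟩
  have hd : Finset.univ.gcd v ≠ 0 := fun h0 => hi₀ (Finset.gcd_eq_zero_iff.mp h0 _ (by simp))
  obtain ⟨c, hc⟩ := Finset.gcd_eq_sum_mul Finset.univ u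
  let θ : FreeGroup (Fin r) →* Multiplicative ℤ :=
    FreeGroup.lift fun i => Multiplicative.ofAdd (u i)
  have hθ : θ.comp φ.toMonoidHom = θ := by
    ext i
    have h1 := coinvariantMatrix_sum_smul φ θ i
    have h2 : Finset.univ.gcd v * ∑ j, coinvariantMatrix φ i j * u j = 0 := by
      refine Eq.trans ?_ (congrFun hMv i)
      rw [Matrix.mulVec, dotProduct, Finset.mul_sum]
      refine Finset.sum_congr rfl fun j hj => ?_
      rw [hvu j hj]
      ring
    have h3 : (θ (φ (FreeGroup.of i))).toAdd - (θ (FreeGroup.of i)).toAdd = 0 := by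
      rw [← h1, ← (mul_eq_zero.mp h2).resolve_left hd]
      simp [θ]
    exact sub_eq_zero.mp h3
  have hθ' : ∀ w, θ (φ w) = (1 : MulAut (Multiplicative ℤ)) (θ w) :=
    fun w => DFunLike.congr_fun hθ w
  have hθz : ∀ n : ℤ, ∀ w, θ ((φ ^ n) w) = θ w :=
    fun n w => by simpa using (map_zpow_apply_of_semiconj (α := 1) hθ' n w)
  have hone : ∃ w, θ w = Multiplicative.ofAdd 1 := by
    change Multiplicative.ofAdd 1 ∈ θ.range
    rw [← hu, hc, ofAdd_sum]
    refine Subgroup.prod_mem _ fun i _ => ?_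
    exact ⟨FreeGroup.of i ^ c i, by
      rw [map_zpow, FreeGroup.lift_apply_of, ← ofAdd_zsmul, smul_eq_mul, mul_comm]⟩
  obtain ⟨w, hw⟩ := hone
  let Θ : FreeByCyclic φ →* Multiplicative ℤ := SemidirectProduct.lift θ 1 fun n => by
    refine MonoidHom.ext fun w => ?_
    change θ ((φ ^ n.toAdd) w) = _
    simp [hθz]
  refine h ⟨(MulEquiv.prodMultiplicative ℤ ℤ).symm.toMonoidHom.comp
    (Θ.prod SemidirectProduct.rightHom), fun x => ?_⟩
  refine ⟨SemidirectProduct.inl w ^ x.toAdd.1 *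
    SemidirectProduct.inr (Multiplicative.ofAdd x.toAdd.2), ?_⟩
  have hΘinl : ∀ y, Θ (SemidirectProduct.inl y) = θ y := SemidirectProduct.lift_inl _ _ _
  have hΘinr : ∀ y, Θ (SemidirectProduct.inr y) = 1 := SemidirectProduct.lift_inr _ _ _
  apply (MulEquiv.prodMultiplicative ℤ ℤ).injective
  refine Prod.ext ?_ ?_
  · change Θ _ = Multiplicative.ofAdd x.toAdd.1
    rw [map_mul, map_zpow, hΘinl, hΘinr, hw, ← ofAdd_zsmul, mul_one, smul_eq_mul, mul_one]
  · change (SemidirectProduct.rightHom (SemidirectProduct.inl w ^ x.toAdd.1 *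
      SemidirectProduct.inr (Multiplicative.ofAdd x.toAdd.2) : FreeByCyclic φ)) = _
    rw [map_mul, map_zpow, SemidirectProduct.rightHom_inl, SemidirectProduct.rightHom_inr,
      one_zpow, one_mul]
    rfl

/-- Away from the coinvariant determinant, no elementary abelian `p`-group of rank two is a
quotient. -/
theorem not_surjective_prod_zmod {r : ℕ} (φ : MulAut (FreeGroup (Fin r))) {p : ℕ} [Fact p.Prime]
    (hp : ¬ p ∣ (coinvariantMatrix φ).det.natAbs) :
    ¬ ∃ f : FreeByCyclic φ →* Multiplicative (ZMod p × ZMod p), Function.Surjective f := by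
  rintro ⟨f, hf⟩
  have hinl : ∀ w, f (SemidirectProduct.inl w) = 1 := fun w => by
    have h1 : f (SemidirectProduct.inl w) ^ (coinvariantMatrix φ).det.natAbs = 1 := by
      rw [← map_pow]
      exact Abelianization.commutator_subset_ker f (inl_pow_mem_commutator φ w)
    have h2 : f (SemidirectProduct.inl w) ^ p = 1 := by
      apply Multiplicative.toAdd.injective
      ext <;> simp
    have h3 := Nat.Coprime.symm ((Nat.Prime.coprime_iff_not_dvd Fact.out).mpr hp)
    rw [← orderOf_eq_one_iff, ← Nat.dvd_one, ← h3]
    exact Nat.dvd_gcd (orderOf_dvd_of_pow_eq_one h1) (orderOf_dvd_of_pow_eq_one h2)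
  have hz : ∀ x, ∃ n : ℤ, f (stable φ) ^ n = x := fun x => by
    obtain ⟨y, rfl⟩ := hf x
    refine ⟨y.right.toAdd, ?_⟩
    conv_rhs => rw [eq_inl_mul_stable_zpow φ y]
    simp [hinl]
  obtain ⟨n, hn⟩ := hz (Multiplicative.ofAdd (1, 0))
  obtain ⟨m, hm⟩ := hz (Multiplicative.ofAdd (0, 1))
  have hn' := congrArg Multiplicative.toAdd hn
  have hm' := congrArg Multiplicative.toAdd hm
  simp only [toAdd_zpow, toAdd_ofAdd, Prod.ext_iff, Prod.smul_fst, Prod.smul_snd] at hn' hm'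
  simp only [zsmul_eq_mul] at hn' hm'
  have h1 := hn'.1
  rcases mul_eq_zero.mp hn'.2 with h0 | h0
  · rw [h0, zero_mul] at h1
    exact zero_ne_one h1
  · have h2 := hm'.2
    simp [h0] at h2

end FreeByCyclic

/-- Reduction of exponent sums modulo `p`. -/
def FreeGroup.modHom (p r : ℕ) : FreeGroup (Fin r) →* Multiplicative (Fin r → ZMod p) :=
  FreeGroup.lift fun i => Multiplicative.ofAdd (Pi.single i 1)

namespace FreeGroup

theorem modHom_surjective (p r : ℕ) [NeZero p] : Function.Surjective (modHom p r) := by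
  intro v
  change v ∈ (modHom p r).range
  have hv : v = ∏ i, Multiplicative.ofAdd (Pi.single i (v.toAdd i)) := by
    rw [← ofAdd_sum, Finset.univ_sum_single]
    rfl
  rw [hv]
  refine Subgroup.prod_mem _ fun i _ => ⟨FreeGroup.of i ^ (v.toAdd i).val, ?_⟩
  rw [map_pow, modHom, FreeGroup.lift_apply_of, ← ofAdd_nsmul, ← Pi.single_smul]
  simp

theorem exists_linearMap_modHom {p r : ℕ} {A : Type*} [AddCommGroup A] [Module (ZMod p) A]
    (g : FreeGroup (Fin r) →* Multiplicative A) :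
    ∃ l : (Fin r → ZMod p) →ₗ[ZMod p] A, ∀ w, l (modHom p r w).toAdd = (g w).toAdd := by
  refine ⟨Fintype.linearCombination (ZMod p) fun i => (g (FreeGroup.of i)).toAdd, fun w => ?_⟩
  have : (AddMonoidHom.toMultiplicative (Fintype.linearCombination (ZMod p)
      fun i => (g (FreeGroup.of i)).toAdd).toAddMonoidHom).comp (modHom p r) = g := by
    ext i
    change Fintype.linearCombination (ZMod p) _ (modHom p r (FreeGroup.of i)).toAdd = _
    simp [modHom, Fintype.linearCombination_apply_single]
  exact DFunLike.congr_fun this w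

theorem rank_le_of_modHom_surjective {p r s : ℕ} [Fact p.Prime]
    (g : FreeGroup (Fin s) →* Multiplicative (Fin r → ZMod p)) (hg : Function.Surjective g) :
    r ≤ s := by
  obtain ⟨l, hl⟩ := exists_linearMap_modHom (p := p) g
  have hl' : Function.Surjective l := fun v => by
    obtain ⟨w, hw⟩ := hg (Multiplicative.ofAdd v)
    exact ⟨(modHom p s w).toAdd, by rw [hl, hw, toAdd_ofAdd]⟩
  simpa using LinearMap.finrank_le_finrank_of_surjective hl'

theorem exists_mulAut_modHom (p : ℕ) [NeZero p] {r : ℕ} (φ : MulAut (FreeGroup (Fin r))) :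
    ∃ α : MulAut (Multiplicative (Fin r → ZMod p)),
      ∀ w, modHom p r (φ w) = α (modHom p r w) := by
  have key : ∀ χ : MulAut (FreeGroup (Fin r)),
      ∃ f : Multiplicative (Fin r → ZMod p) →* Multiplicative (Fin r → ZMod p),
        ∀ w, f (modHom p r w) = modHom p r (χ w) := fun χ => by
    obtain ⟨l, hl⟩ := exists_linearMap_modHom (p := p) ((modHom p r).comp χ.toMonoidHom)
    exact ⟨AddMonoidHom.toMultiplicative l.toAddMonoidHom, hl⟩
  obtain ⟨f, hf⟩ := key φ
  obtain ⟨f', hf'⟩ := key φ⁻¹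
  refine ⟨MonoidHom.toMulEquiv f f' ?_ ?_, fun w => (hf w).symm⟩ <;>
  · refine MonoidHom.ext fun v => ?_
    obtain ⟨w, rfl⟩ := modHom_surjective p r v
    simp [hf, hf']

end FreeGroup

namespace FreeByCyclic

/-- The image of the fibre under a surjection contains the commutator subgroup. -/
theorem commutator_le_map_fibre {s : ℕ} {ψ : MulAut (FreeGroup (Fin s))} {Q : Type*} [Group Q]
    {f : FreeByCyclic ψ →* Q} (hf : Function.Surjective f) :
    commutator Q ≤ (f.comp SemidirectProduct.inl).range := by
  have hN : (f.comp SemidirectProduct.inl).range =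
      (SemidirectProduct.inl : _ →* FreeByCyclic ψ).range.map f := MonoidHom.range_comp _ _
  have : (SemidirectProduct.inl : _ →* FreeByCyclic ψ).range.Normal := by
    rw [SemidirectProduct.range_inl_eq_ker_rightHom]
    infer_instance
  have : (f.comp SemidirectProduct.inl).range.Normal := hN ▸ this.map f hf
  refine Subgroup.Normal.commutator_le_of_self_sup_commutative_eq_top
    (H := Subgroup.zpowers (f (stable ψ))) (eq_top_iff.mpr fun x _ => ?_) inferInstance
  obtain ⟨y, rfl⟩ := hf x
  rw [eq_inl_mul_stable_zpow ψ y, map_mul, map_zpow]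
  exact Subgroup.mul_mem_sup ⟨y.left, rfl⟩ (Subgroup.zpow_mem _ (Subgroup.mem_zpowers _) _)

theorem rank_le_of_finite_quotients {r s : ℕ} {φ : MulAut (FreeGroup (Fin r))}
    {ψ : MulAut (FreeGroup (Fin s))} (hφ : (coinvariantMatrix φ).det ≠ 0)
    (hψ : (coinvariantMatrix ψ).det ≠ 0)
    (h : ∀ (Q : Type) (_ : Group Q) (_ : Finite Q),
      (∃ f : FreeByCyclic φ →* Q, Function.Surjective f) →
        ∃ f : FreeByCyclic ψ →* Q, Function.Surjective f) :
    r ≤ s := by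
  obtain ⟨p, hp, hprime⟩ := Nat.exists_infinite_primes ((coinvariantMatrix φ).det.natAbs + 1)
  have : Fact p.Prime := ⟨hprime⟩
  have hpd : ¬ p ∣ (coinvariantMatrix φ).det.natAbs := fun hd => by
    have := Nat.le_of_dvd (Int.natAbs_pos.mpr hφ) hd
    omega
  obtain ⟨α, hα⟩ := FreeGroup.exists_mulAut_modHom p φ
  have : Finite (MulAut (Multiplicative (Fin r → ZMod p))) :=
    Finite.of_injective _ DFunLike.coe_injective
  let m := orderOf α * (coinvariantMatrix ψ).det.natAbs
  have : NeZero m := ⟨mul_ne_zero (orderOf_pos α).ne' (Int.natAbs_ne_zero.mpr hψ)⟩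
  let β : Multiplicative (ZMod m) →* MulAut (Multiplicative (Fin r → ZMod p)) :=
    AddMonoidHom.toMultiplicativeLeft (ZMod.lift m
      ⟨zmultiplesHom (Additive (MulAut (Multiplicative (Fin r → ZMod p)))) (Additive.ofMul α), by
        rw [zmultiplesHom_apply, natCast_zsmul, ← ofMul_pow, pow_mul, pow_orderOf_eq_one, one_pow,
          ofMul_one]⟩)
  have hβ : ∀ n : ℤ, β (Multiplicative.ofAdd (n : ZMod m)) = α ^ n := fun n => by
    change Additive.toMul (ZMod.lift m _ (n : ZMod m)) = _
    rw [ZMod.lift_coe]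
    rfl
  let Q := SemidirectProduct (Multiplicative (Fin r → ZMod p)) (Multiplicative (ZMod m)) β
  have : Finite Q := Finite.of_equiv _ SemidirectProduct.equivProd.symm
  let red : FreeByCyclic φ →* Q := SemidirectProduct.map (FreeGroup.modHom p r)
    (AddMonoidHom.toMultiplicative (Int.castAddHom (ZMod m))) fun n => by
      refine MonoidHom.ext fun w => ?_
      change FreeGroup.modHom p r ((φ ^ n.toAdd) w) =
        β (Multiplicative.ofAdd ((n.toAdd : ℤ) : ZMod m)) (FreeGroup.modHom p r w)
      rw [hβ, map_zpow_apply_of_semiconj hα]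
  have hred : Function.Surjective red := fun x => by
    obtain ⟨w, hw⟩ := FreeGroup.modHom_surjective p r x.left
    obtain ⟨n, hn⟩ := ZMod.intCast_surjective x.right.toAdd
    exact ⟨⟨w, Multiplicative.ofAdd n⟩, SemidirectProduct.ext hw hn⟩
  obtain ⟨f, hf⟩ := h Q inferInstance inferInstance ⟨red, hred⟩
  have hfibre : ∀ v, (SemidirectProduct.inl v : Q) ∈ (f.comp SemidirectProduct.inl).range := by
    intro v
    have hpow : (SemidirectProduct.inl v : Q) ^ (coinvariantMatrix φ).det.natAbs ∈
        (f.comp SemidirectProduct.inl).range := by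
      obtain ⟨w, rfl⟩ := FreeGroup.modHom_surjective p r v
      refine commutator_le_map_fibre hf ?_
      have hw := Subgroup.mem_map_of_mem red (inl_pow_mem_commutator φ w)
      rw [map_pow] at hw
      have hinl : red (SemidirectProduct.inl w) =
        SemidirectProduct.inl (FreeGroup.modHom p r w) := SemidirectProduct.map_inl ..
      rw [hinl] at hw
      rw [commutator_def, Subgroup.map_commutator] at hw
      exact Subgroup.commutator_mono le_top le_top hw
    have hpp : (SemidirectProduct.inl v : Q) ^ p ∈ (f.comp SemidirectProduct.inl).range := by
      have hv : v ^ p = 1 := by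
        apply Multiplicative.toAdd.injective
        ext
        simp
      rw [← map_pow, hv, map_one]
      exact one_mem _
    have hcop : IsCoprime ((coinvariantMatrix φ).det.natAbs : ℤ) (p : ℤ) :=
      Nat.isCoprime_iff_coprime.mpr ((Nat.Prime.coprime_iff_not_dvd hprime).mpr hpd).symm
    obtain ⟨a, b, hab⟩ := hcop
    have := mul_mem (Subgroup.zpow_mem _ hpow a) (Subgroup.zpow_mem _ hpp b)
    rwa [← zpow_natCast, ← zpow_natCast, ← zpow_mul, ← zpow_mul, ← zpow_add, mul_comm _ a,
      mul_comm _ b, hab, zpow_one] at this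
  have htriv : ∀ w, β (f (SemidirectProduct.inl w)).right = 1 := fun w => by
    have h1 : (f (SemidirectProduct.inl w)).right ^ (coinvariantMatrix ψ).det.natAbs = 1 := by
      have := Abelianization.commutator_subset_ker (SemidirectProduct.rightHom.comp f)
        (inl_pow_mem_commutator ψ w)
      rw [MonoidHom.mem_ker, map_pow] at this
      exact this
    obtain ⟨n, hn⟩ := ZMod.intCast_surjective (f (SemidirectProduct.inl w)).right.toAdd
    have hn' : (f (SemidirectProduct.inl w)).right = Multiplicative.ofAdd (n : ZMod m) := by
      rw [hn, ofAdd_toAdd]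
    rw [hn', ← ofAdd_nsmul, nsmul_eq_mul, ofAdd_eq_one] at h1
    rw [hn', hβ, ← orderOf_dvd_iff_zpow_eq_one]
    have h2 : (m : ℤ) ∣ ((coinvariantMatrix ψ).det.natAbs : ℤ) * n := by
      rw [← ZMod.intCast_zmod_eq_zero_iff_dvd]
      rw [Int.cast_mul, Int.cast_natCast, h1]
    have h3 : ((coinvariantMatrix ψ).det.natAbs : ℤ) ≠ 0 := by
      exact_mod_cast Int.natAbs_ne_zero.mpr hψ
    refine Int.dvd_of_mul_dvd_mul_left h3 ?_
    convert h2 using 1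
    simp only [m, Nat.cast_mul, mul_comm]
  let g : FreeGroup (Fin s) →* Multiplicative (Fin r → ZMod p) :=
    { toFun := fun w => (f (SemidirectProduct.inl w)).left
      map_one' := by simp
      map_mul' := fun x y => by
        rw [map_mul, map_mul, SemidirectProduct.mul_left, htriv, MulAut.one_apply] }
  refine FreeGroup.rank_le_of_modHom_surjective g fun v => ?_
  obtain ⟨w, hw⟩ := hfibre v
  exact ⟨w, congrArg SemidirectProduct.left hw⟩

end FreeByCyclic

/-- If `φ` is atoroidal, `b₁(F_r ⋊_φ ℤ) = 1`, and `F_s ⋊_ψ ℤ` has the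
same finite quotients as `F_r ⋊_φ ℤ`, then `r = s`. -/
theorem profinite_detects_rank (r s : ℕ)
    (φ : MulAut (FreeGroup (Fin r))) (ψ : MulAut (FreeGroup (Fin s)))
    (hφ : Atoroidal φ) (hb : FirstBettiOne (FreeByCyclic φ))
    (h : SameFiniteQuotients (FreeByCyclic ψ) (FreeByCyclic φ)) :
    r = s := by
  have hdφ := FreeByCyclic.det_coinvariantMatrix_ne_zero φ hb.2
  have hdψ : (coinvariantMatrix ψ).det ≠ 0 := by
    refine FreeByCyclic.det_coinvariantMatrix_ne_zero ψ fun ⟨f, hf⟩ => ?_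
    obtain ⟨p, hp, hprime⟩ := Nat.exists_infinite_primes ((coinvariantMatrix φ).det.natAbs + 1)
    have : Fact p.Prime := ⟨hprime⟩
    have hpd : ¬ p ∣ (coinvariantMatrix φ).det.natAbs := fun hd => by
      have := Nat.le_of_dvd (Int.natAbs_pos.mpr hdφ) hd
      omega
    have : Finite (Multiplicative (ZMod p × ZMod p)) := inferInstanceAs (Finite (ZMod p × ZMod p))
    let q : Multiplicative (ℤ × ℤ) →* Multiplicative (ZMod p × ZMod p) :=
      AddMonoidHom.toMultiplicative
        ((Int.castAddHom (ZMod p)).prodMap (Int.castAddHom (ZMod p)))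
    have hq : Function.Surjective q := fun x => by
      obtain ⟨a, ha⟩ := ZMod.intCast_surjective x.toAdd.1
      obtain ⟨b, hb⟩ := ZMod.intCast_surjective x.toAdd.2
      exact ⟨Multiplicative.ofAdd (a, b), Prod.ext ha hb⟩
    exact FreeByCyclic.not_surjective_prod_zmod φ hpd
      ((h _ inferInstance inferInstance).mp ⟨q.comp f, hq.comp hf⟩)
  exact le_antisymm
    (FreeByCyclic.rank_le_of_finite_quotients hdφ hdψ fun Q i j => (h Q i j).mpr)
    (FreeByCyclic.rank_le_of_finite_quotients hdψ hdφ fun Q i j => (h Q i j).mp)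
end

section
/- Finitely generated abelian groups are profinitely rigid: if A and B are finitely generated abelian groups with the same finite quotients, then A is isomorphic to B. -/
/-- If `B` surjects onto `A` modulo `n`-th powers, the index of the subgroup of `n`-th powers
in `A` divides the one in `B`. -/
lemma index_range_powMonoidHom_dvd {A B : Type*} [CommGroup A] [CommGroup B] (n : ℕ)
    (f : B →* A ⧸ (powMonoidHom n : A →* A).range) (hf : Function.Surjective f) :
    (powMonoidHom n : A →* A).range.index ∣ (powMonoidHom n : B →* B).range.index := by
  have hker : f.ker.index = (powMonoidHom n : A →* A).range.index := by
    rw [Subgroup.index_ker, MonoidHom.range_eq_top.mpr hf, Subgroup.card_top,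
      Subgroup.index_eq_card]
  rw [← hker]
  apply Subgroup.index_dvd_of_le
  rintro _ ⟨b, rfl⟩
  obtain ⟨a, ha⟩ := QuotientGroup.mk_surjective (f b)
  rw [MonoidHom.mem_ker, powMonoidHom_apply, map_pow, ← ha, ← QuotientGroup.mk_pow,
    QuotientGroup.eq_one_iff]
  exact ⟨a, rfl⟩

lemma SameFiniteQuotients.index_range_powMonoidHom_eq {A B : Type} [CommGroup A] [CommGroup B]
    [Group.FG A] [Group.FG B] (h : SameFiniteQuotients A B) {n : ℕ} (hn : n ≠ 0) :
    (powMonoidHom n : A →* A).range.index = (powMonoidHom n : B →* B).range.index := by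
  have := Subgroup.finiteIndex_range_powMonoidHom_of_fg A hn
  have := Subgroup.finiteIndex_range_powMonoidHom_of_fg B hn
  obtain ⟨f, hf⟩ := (h (A ⧸ (powMonoidHom n : A →* A).range) inferInstance inferInstance).mp
    ⟨QuotientGroup.mk' _, QuotientGroup.mk'_surjective _⟩
  obtain ⟨g, hg⟩ := (h (B ⧸ (powMonoidHom n : B →* B).range) inferInstance inferInstance).mpr
    ⟨QuotientGroup.mk' _, QuotientGroup.mk'_surjective _⟩
  exact Nat.dvd_antisymm (index_range_powMonoidHom_dvd n f hf)
    (index_range_powMonoidHom_dvd n g hg)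

lemma index_range_powMonoidHom_congr {A B : Type*} [CommGroup A] [CommGroup B] (e : A ≃* B)
    (n : ℕ) :
    (powMonoidHom n : A →* A).range.index = (powMonoidHom n : B →* B).range.index := by
  rw [← Subgroup.index_map_equiv _ e]
  congr 1
  ext b
  constructor
  · rintro ⟨_, ⟨a, rfl⟩, rfl⟩
    exact ⟨e a, by simp⟩
  · rintro ⟨b, rfl⟩
    exact ⟨_, ⟨e.symm b, rfl⟩, by simp⟩

lemma index_range_powMonoidHom_zmod (m n : ℕ) :
    (powMonoidHom n : Multiplicative (ZMod m) →* _).range.index = m.gcd n := by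
  rcases eq_or_ne m 0 with rfl | hm
  · rw [Nat.gcd_zero_left]
    refine Eq.trans ?_ ((AddSubgroup.index_toSubgroup _).trans (Int.index_zmultiples n))
    congr 1
    ext x
    constructor
    · rintro ⟨y, rfl⟩
      exact ⟨y.toAdd, mul_comm _ _⟩
    · rintro ⟨y, rfl⟩
      refine ⟨Multiplicative.ofAdd y, ?_⟩
      change n • y = y • (n : ℤ)
      rw [nsmul_eq_mul, smul_eq_mul, mul_comm]
  · have : NeZero m := ⟨hm⟩
    rw [IsCyclic.index_powMonoidHom_range]
    simp

lemma index_pi_univ {J : Type*} [Fintype J] {G : J → Type*} [∀ j, Group (G j)]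
    (H : ∀ j, Subgroup (G j)) :
    (Subgroup.pi Set.univ H).index = ∏ j, (H j).index := by
  simp_rw [Subgroup.index, ← Nat.card_pi]
  refine Nat.card_congr
    ((Quotient.congrRight fun x y ↦ ?_).trans (Setoid.piQuotientEquiv _).symm)
  rw [QuotientGroup.leftRel_pi]

lemma index_range_powMonoidHom_pi {J : Type*} [Fintype J] (G : J → Type*) [∀ j, CommGroup (G j)]
    (n : ℕ) :
    (powMonoidHom n : (∀ j, G j) →* ∀ j, G j).range.index =
      ∏ j, (powMonoidHom n : G j →* G j).range.index := by
  rw [← index_pi_univ]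
  congr 1
  ext x
  constructor
  · rintro ⟨y, rfl⟩ j -
    exact ⟨y j, rfl⟩
  · intro hx
    choose y hy using fun j ↦ hx j (Set.mem_univ j)
    exact ⟨y, funext hy⟩

lemma index_range_powMonoidHom_pi_zmod {J : Type*} [Fintype J] (m : J → ℕ) (n : ℕ) :
    (powMonoidHom n : (∀ j, Multiplicative (ZMod (m j))) →* _).range.index =
      ∏ j, (m j).gcd n := by
  simp_rw [index_range_powMonoidHom_pi, index_range_powMonoidHom_zmod]

/-- A finitely generated abelian group is a finite product of infinite cyclic groups and nontrivial
cyclic groups of prime power order. -/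
lemma exists_mulEquiv_pi_zmod (A : Type*) [CommGroup A] [Group.FG A] :
    ∃ (J : Type) (_ : Fintype J) (m : J → ℕ), (∀ j, m j = 0 ∨ IsPrimePow (m j)) ∧
      Nonempty (A ≃* ∀ j, Multiplicative (ZMod (m j))) := by
  classical
  obtain ⟨ι, κ, _, _, p, hp, e, ⟨φ⟩⟩ := CommGroup.equiv_free_prod_prod_multiplicative_zmod A
  let ψ : (κ → Multiplicative ℤ) × (∀ i, Multiplicative (ZMod (p i ^ e i))) →*
      ∀ j : κ ⊕ {i // e i ≠ 0},
        Multiplicative (ZMod (Sum.elim (fun _ ↦ 0) (fun i ↦ p i.1 ^ e i.1) j)) :=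
    MonoidHom.pi fun j ↦ match j with
      | .inl k => (Pi.evalMonoidHom _ k).comp (MonoidHom.fst _ _)
      | .inr i => (Pi.evalMonoidHom _ i.1).comp (MonoidHom.snd _ _)
  have hψ : Function.Bijective ψ := by
    constructor
    · intro x y hxy
      ext i
      · exact congrFun hxy (.inl i)
      · by_cases hi : e i = 0
        · have : Subsingleton (ZMod (p i ^ e i)) := by
            rw [hi, pow_zero]; infer_instance
          exact Subsingleton.elim (α := ZMod (p i ^ e i)) _ _
        · exact congrFun hxy (.inr ⟨i, hi⟩)
    · intro y
      refine ⟨(fun k ↦ y (.inl k), fun i ↦ if hi : e i ≠ 0 then y (.inr ⟨i, hi⟩) else 1), ?_⟩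
      funext j
      rcases j with k | ⟨i, hi⟩
      · rfl
      · exact dif_pos hi
  refine ⟨κ ⊕ {i // e i ≠ 0}, inferInstance, _, ?_, ⟨φ.trans (MulEquiv.ofBijective ψ hψ)⟩⟩
  rintro (k | ⟨i, hi⟩)
  · exact .inl rfl
  · exact .inr ((hp i).isPrimePow.pow hi)

lemma gcd_prime_pow_succ {p : ℕ} (hp : p.Prime) (m k : ℕ) :
    m.gcd (p ^ (k + 1)) = m.gcd (p ^ k) * if p ^ (k + 1) ∣ m then p else 1 := by
  split_ifs with h
  · rw [Nat.gcd_eq_right h, Nat.gcd_eq_right ((pow_dvd_pow p k.le_succ).trans h), pow_succ]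
  · rw [mul_one]
    apply Nat.dvd_antisymm
    · obtain ⟨i, hi, hi'⟩ := (Nat.dvd_prime_pow hp).mp (m.gcd_dvd_right (p ^ (k + 1)))
      have hik : i ≤ k := by
        by_contra! hlt
        obtain rfl : i = k + 1 := by omega
        exact h (hi' ▸ m.gcd_dvd_left _)
      exact Nat.dvd_gcd (m.gcd_dvd_left _) (hi' ▸ pow_dvd_pow p hik)
    · exact Nat.gcd_dvd_gcd_of_dvd_right _ (pow_dvd_pow p k.le_succ)

section Families

variable {J K : Type*} [Fintype J] {f : J → ℕ}

open Finset

lemma exists_forall_dvd_iff_eq_zero (f : J → ℕ) :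
    ∃ N, ∀ n > N, ∀ j, n ∣ f j ↔ f j = 0 := by
  refine ⟨∑ j, f j, fun n hn j ↦ ⟨fun hd ↦ ?_, fun h0 ↦ h0 ▸ dvd_zero n⟩⟩
  exact Nat.eq_zero_of_dvd_of_lt hd ((single_le_sum (by simp) (mem_univ j)).trans_lt hn)

lemma card_eq_prime_pow_add (hf : ∀ j, f j = 0 ∨ IsPrimePow (f j)) {p : ℕ} (hp : p.Prime) (k : ℕ) :
    #{j | f j = p ^ (k + 1)} + #{j | p ^ (k + 2) ∣ f j} = #{j | p ^ (k + 1) ∣ f j} := by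
  classical
  rw [← card_union_of_disjoint]
  · congr 1
    ext j
    simp only [mem_union, mem_filter, mem_univ, true_and]
    constructor
    · rintro (h | h)
      · rw [h]
      · exact (pow_dvd_pow p (by omega)).trans h
    · intro hd
      rcases hf j with h0 | h
      · simp [h0]
      · obtain ⟨q, e, hq, -, he⟩ := (isPrimePow_nat_iff _).mp h
        rw [← he] at hd ⊢
        obtain rfl : p = q := (Nat.prime_dvd_prime_iff_eq hp hq).mp
          (hp.dvd_of_dvd_pow ((dvd_pow_self p k.succ_ne_zero).trans hd))
        rw [Nat.pow_dvd_pow_iff_le_right hp.one_lt] at hd ⊢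
        rcases hd.eq_or_lt with rfl | hlt
        · exact .inl rfl
        · exact .inr hlt
  · rw [disjoint_filter]
    intro j _ h
    rw [h, Nat.pow_dvd_pow_iff_le_right hp.one_lt]
    omega

variable [Fintype K] {g : K → ℕ}

lemma card_prime_pow_dvd_eq (h : ∀ n ≠ 0, ∏ j, (f j).gcd n = ∏ j, (g j).gcd n) {p : ℕ}
    (hp : p.Prime) (k : ℕ) : #{j | p ^ (k + 1) ∣ f j} = #{j | p ^ (k + 1) ∣ g j} := by
  have h₁ := h (p ^ (k + 1)) (pow_ne_zero _ hp.ne_zero)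
  have h₀ := h (p ^ k) (pow_ne_zero _ hp.ne_zero)
  simp_rw [gcd_prime_pow_succ hp, prod_mul_distrib, h₀, prod_ite, prod_const_one, mul_one,
    prod_const] at h₁
  refine Nat.pow_right_injective hp.two_le (Nat.eq_of_mul_eq_mul_left ?_ h₁)
  exact prod_pos fun j _ ↦ Nat.gcd_pos_of_pos_right _ (pow_pos hp.pos _)

lemma card_eq_zero_eq (h : ∀ n ≠ 0, ∏ j, (f j).gcd n = ∏ j, (g j).gcd n) :
    #{j | f j = 0} = #{j | g j = 0} := by
  obtain ⟨N, hN⟩ := exists_forall_dvd_iff_eq_zero f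
  obtain ⟨M, hM⟩ := exists_forall_dvd_iff_eq_zero g
  obtain ⟨p, hle, hp⟩ := Nat.exists_infinite_primes (N + M + 1)
  have := card_prime_pow_dvd_eq h hp 0
  simpa [hN p (by omega), hM p (by omega)] using this

/-- A finite family of zeros and prime powers is determined up to reindexing by the products of its
gcds with positive integers. -/
lemma exists_equiv_of_prod_gcd_eq (hf : ∀ j, f j = 0 ∨ IsPrimePow (f j))
    (hg : ∀ j, g j = 0 ∨ IsPrimePow (g j))
    (h : ∀ n ≠ 0, ∏ j, (f j).gcd n = ∏ j, (g j).gcd n) :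
    ∃ σ : J ≃ K, ∀ j, g (σ j) = f j := by
  have key (c : ℕ) : #{j | f j = c} = #{j | g j = c} := by
    by_cases hc : c = 0 ∨ IsPrimePow c
    · rcases hc with rfl | hc
      · exact card_eq_zero_eq h
      · obtain ⟨p, k, hp, hk, rfl⟩ := (isPrimePow_nat_iff _).mp hc
        obtain ⟨k, rfl⟩ := Nat.exists_eq_add_one.mpr hk
        have := card_eq_prime_pow_add hf hp k
        have := card_eq_prime_pow_add hg hp k
        have := card_prime_pow_dvd_eq h hp k
        have : #{j | p ^ (k + 2) ∣ f j} = #{j | p ^ (k + 2) ∣ g j} :=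
          card_prime_pow_dvd_eq h hp (k + 1)
        omega
    · rw [filter_false_of_mem fun j _ (hj : f j = c) ↦ hc (hj ▸ hf j),
        filter_false_of_mem fun j _ (hj : g j = c) ↦ hc (hj ▸ hg j), card_empty, card_empty]
  have e (c : ℕ) : {j // f j = c} ≃ {j // g j = c} :=
    Fintype.equivOfCardEq (by rw [Fintype.card_subtype, Fintype.card_subtype, key])
  exact ⟨Equiv.ofFiberEquiv e, Equiv.ofFiberEquiv_map e⟩

end Families

/-- Finitely generated abelian groups are profinitely rigid. -/
theorem fg_abelian_profinitely_rigid (A B : Type) [CommGroup A] [CommGroup B]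
    [Group.FG A] [Group.FG B] (h : SameFiniteQuotients A B) :
    Nonempty (A ≃* B) := by
  obtain ⟨J, _, f, hf, ⟨φ⟩⟩ := exists_mulEquiv_pi_zmod A
  obtain ⟨K, _, g, hg, ⟨ψ⟩⟩ := exists_mulEquiv_pi_zmod B
  obtain ⟨σ, hσ⟩ := exists_equiv_of_prod_gcd_eq hf hg fun n hn ↦ by
    rw [← index_range_powMonoidHom_pi_zmod, ← index_range_powMonoidHom_pi_zmod,
      ← index_range_powMonoidHom_congr φ, ← index_range_powMonoidHom_congr ψ,
      h.index_range_powMonoidHom_eq hn]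
  obtain rfl : f = g ∘ σ := funext fun j ↦ (hσ j).symm
  let e : (∀ j, Multiplicative (ZMod (g (σ j)))) ≃* ∀ k, Multiplicative (ZMod (g k)) :=
    { Equiv.piCongrLeft (fun k ↦ Multiplicative (ZMod (g k))) σ with
      map_mul' := fun x y ↦ by
        funext k
        obtain ⟨j, rfl⟩ := σ.surjective k
        simp }
  exact ⟨φ.trans (e.trans ψ.symm)⟩
end

section
/- Free groups are profinitely rigid among themselves: if r and s are natural numbers such that the free groups F_r and F_s have the same finite quotients, then r = s, and hence F_r is isomorphic to F_s. -/
/-- A homomorphism from `F_s` onto `(ℤ/2)^r` forces `r ≤ s`. -/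
theorem le_of_surjective_freeGroup_zmod_two {r s : ℕ}
    (f : FreeGroup (Fin s) →* Multiplicative (Fin r → ZMod 2))
    (hf : Function.Surjective f) : r ≤ s := by
  set v : Fin s → Fin r → ZMod 2 := fun i => (f (FreeGroup.of i)).toAdd with hv
  have mem_span : ∀ x, (f x).toAdd ∈ Submodule.span (ZMod 2) (Set.range v) := by
    intro x
    induction x using FreeGroup.induction_on with
    | C1 => simp
    | of i => exact Submodule.subset_span ⟨i, rfl⟩
    | inv_of i ih => simpa using ih
    | mul x y hx hy => simpa using add_mem hx hy
  have span_eq_top : Submodule.span (ZMod 2) (Set.range v) = ⊤ := by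
    refine eq_top_iff.2 fun w _ => ?_
    obtain ⟨x, hx⟩ := hf (Multiplicative.ofAdd w)
    simpa [hx] using mem_span x
  have h := finrank_range_le_card (R := ZMod 2) v
  rw [Set.finrank, span_eq_top] at h
  simpa using h

/-- The free group `F_r` maps onto `(ℤ/2)^r`. -/
theorem exists_surjective_freeGroup_zmod_two (r : ℕ) :
    ∃ f : FreeGroup (Fin r) →* Multiplicative (Fin r → ZMod 2), Function.Surjective f := by
  refine ⟨FreeGroup.lift fun i => Multiplicative.ofAdd (Pi.single i 1), fun w => ?_⟩
  refine ⟨(List.ofFn fun i => FreeGroup.of i ^ (w.toAdd i).val).prod, ?_⟩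
  rw [map_list_prod, List.map_ofFn, List.prod_ofFn]
  apply Multiplicative.toAdd.injective
  ext j
  simp [toAdd_prod, Finset.sum_apply, Pi.single_apply, -ZMod.natCast_val, ZMod.natCast_zmod_val]

theorem le_of_sameFiniteQuotients_freeGroup {r s : ℕ}
    (h : SameFiniteQuotients (FreeGroup (Fin r)) (FreeGroup (Fin s))) : r ≤ s := by
  obtain ⟨f, hf⟩ := (h (Multiplicative (Fin r → ZMod 2)) inferInstance
    (inferInstanceAs (Finite (Fin r → ZMod 2)))).1 (exists_surjective_freeGroup_zmod_two r)
  exact le_of_surjective_freeGroup_zmod_two f hf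

/-- Free groups are profinitely rigid among themselves. -/
theorem free_groups_profinitely_rigid (r s : ℕ)
    (h : SameFiniteQuotients (FreeGroup (Fin r)) (FreeGroup (Fin s))) :
    r = s ∧ Nonempty (FreeGroup (Fin r) ≃* FreeGroup (Fin s)) := by
  obtain rfl : r = s := le_antisymm (le_of_sameFiniteQuotients_freeGroup h)
    (le_of_sameFiniteQuotients_freeGroup fun Q _ _ => (h Q _ ‹_›).symm)
  exact ⟨rfl, ⟨MulEquiv.refl _⟩⟩
end

section
/- The set of finite quotients of a finitely generated group determines its abelianisation: if G and H are finitely generated groups with the same finite quotients, then the abelianization of G is isomorphic to the abelianization of H. -/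
/-- The map `ℤ^ι × T → (ℤ/m)^ι × T` reducing the free coordinates modulo `m`. -/
def reduceFree (ι T : Type*) [AddCommGroup T] (m : ℕ) :
    (ι → ℤ) × T →+ (ι → ZMod m) × T :=
  ((Int.castAddHom (ZMod m)).compLeft ι).prodMap (AddMonoidHom.id T)

theorem reduceFree_surjective (ι T : Type*) [AddCommGroup T] (m : ℕ) :
    Function.Surjective (reduceFree ι T m) :=
  ((ZMod.intCast_surjective (n := m)).comp_left).prodMap Function.surjective_id

theorem exists_nsmul_of_reduceFree_eq_zero {ι T : Type*} [AddCommGroup T] {m : ℕ}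
    {x : (ι → ℤ) × T} (hx : reduceFree ι T m x = 0) : ∃ y, x = m • y := by
  have h₁ : ∀ i, (m : ℤ) ∣ x.1 i := fun i =>
    (ZMod.intCast_zmod_eq_zero_iff_dvd _ _).1 (congrFun (congrArg Prod.fst hx) i)
  have h₂ : x.2 = 0 := congrArg Prod.snd hx
  choose y hy using h₁
  refine ⟨(y, 0), Prod.ext (funext fun i => ?_) ?_⟩
  · simpa using hy i
  · simpa using h₂

theorem nsmul_modEq_zero {ι T : Type*} [AddCommGroup T] {m : ℕ}
    (hT : ∀ t : T, m • t = 0) (x : (ι → ZMod m) × T) : m • x = 0 := by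
  refine Prod.ext (funext fun i => ?_) (hT x.2)
  simp

/-- A surjection from `ℤ^ι × U` onto a group killed by `m` factors through `(ℤ/m)^ι × U`. -/
theorem exists_surjective_of_nsmul_eq_zero {ι U X : Type*} [AddCommGroup U] [AddCommGroup X]
    {m : ℕ} (hX : ∀ x : X, m • x = 0) (f : (ι → ℤ) × U →+ X) (hf : Function.Surjective f) :
    ∃ g : (ι → ZMod m) × U →+ X, Function.Surjective g := by
  have hker : (reduceFree ι U m).ker ≤ f.ker := by
    intro x hx
    obtain ⟨y, rfl⟩ := exists_nsmul_of_reduceFree_eq_zero hx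
    rw [AddMonoidHom.mem_ker, map_nsmul, hX]
  refine ⟨AddMonoidHom.liftOfSurjective _ (reduceFree_surjective ι U m) ⟨f, hker⟩, fun x => ?_⟩
  obtain ⟨y, rfl⟩ := hf x
  exact ⟨reduceFree ι U m y, AddMonoidHom.liftOfRightInverse_comp_apply _ _ _ _ _⟩

/-- An isomorphism `(ℤ/N²)^ι × T ≃ (ℤ/N²)^κ × U` induces an injection on the components killed
by `N`. -/
theorem injective_snd_of_addEquiv {ι κ T U : Type*} [AddCommGroup T] [AddCommGroup U]
    {N : ℕ} (hN : N ≠ 0) (hT : ∀ t : T, N • t = 0)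
    (f : (ι → ZMod (N * N)) × T ≃+ (κ → ZMod (N * N)) × U) :
    Function.Injective fun t : T => (f (0, t)).2 := by
  let g : T →+ U := (AddMonoidHom.snd _ _).comp (f.toAddMonoidHom.comp (AddMonoidHom.inr _ _))
  change Function.Injective g
  refine (injective_iff_map_eq_zero g).2 fun t ht => ?_
  have hfst : N • (f (0, t)).1 = 0 := by
    have : N • f (0, t) = 0 := by
      rw [← map_nsmul, Prod.smul_mk, hT, smul_zero, Prod.mk_zero_zero, map_zero]
    exact congrArg Prod.fst this
  have hdiv : ∀ i, ∃ w : ZMod (N * N), (f (0, t)).1 i = N • w := by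
    intro i
    obtain ⟨a, ha⟩ := ZMod.intCast_surjective ((f (0, t)).1 i)
    have h0 : ((N * a : ℤ) : ZMod (N * N)) = 0 := by
      have := congrFun hfst i
      rw [Pi.smul_apply, ← ha] at this
      simpa using this
    rw [ZMod.intCast_zmod_eq_zero_iff_dvd, Nat.cast_mul] at h0
    obtain ⟨b, rfl⟩ := Int.dvd_of_mul_dvd_mul_left (by exact_mod_cast hN) h0
    exact ⟨b, by rw [← ha]; simp⟩
  choose w hw using hdiv
  have hf : f (0, t) = N • (w, (0 : U)) := by
    refine Prod.ext (funext hw) ?_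
    exact ht.trans (smul_zero N).symm
  have ht' : ((0 : ι → ZMod (N * N)), t) = N • f.symm (w, 0) := by
    rw [← map_nsmul, ← hf, f.symm_apply_apply]
  exact (congrArg Prod.snd ht').trans (hT _)

/-- A surjection from a group onto an abelian group factors through the abelianization. -/
theorem exists_surjective_of_abelianization {H B X : Type*} [Group H] [AddCommGroup B]
    [AddCommGroup X] (e : Additive (Abelianization H) ≃+ B) (f : H →* Multiplicative X)
    (hf : Function.Surjective f) : ∃ g : B →+ X, Function.Surjective g := by
  refine ⟨(MonoidHom.toAdditiveLeft (Abelianization.lift f)).comp e.symm.toAddMonoidHom,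
    fun x => ?_⟩
  obtain ⟨y, hy⟩ := hf (Multiplicative.ofAdd x)
  refine ⟨e (Additive.ofMul (Abelianization.of y)), ?_⟩
  simp [hy]

theorem exists_surjective_to_abelianization {G A X : Type*} [Group G] [AddCommGroup A]
    [AddCommGroup X] (e : Additive (Abelianization G) ≃+ A) (g : A →+ X)
    (hg : Function.Surjective g) : ∃ f : G →* Multiplicative X, Function.Surjective f := by
  refine ⟨(AddMonoidHom.toMultiplicativeRight (g.comp e.toAddMonoidHom)).comp Abelianization.of,
    fun x => ?_⟩
  obtain ⟨a, ha⟩ := hg x.toAdd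
  obtain ⟨y, hy⟩ := QuotientGroup.mk_surjective (e.symm a).toMul
  refine ⟨y, ?_⟩
  have hy' : Additive.ofMul (Abelianization.of y) = e.symm a := congrArg Additive.ofMul hy
  simp [hy', ha]

theorem exists_surjective_reduction {G H : Type} [Group G] [Group H] {r s : ℕ} {T U : Type}
    [AddCommGroup T] [AddCommGroup U] [Finite T]
    (hGH : SameFiniteQuotients G H)
    (eG : Additive (Abelianization G) ≃+ (Fin r → ℤ) × T)
    (eH : Additive (Abelianization H) ≃+ (Fin s → ℤ) × U)
    {m : ℕ} [NeZero m] (hT : ∀ t : T, m • t = 0) :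
    ∃ g : (Fin s → ZMod m) × U →+ (Fin r → ZMod m) × T, Function.Surjective g := by
  obtain ⟨f, hf⟩ := (hGH (Multiplicative ((Fin r → ZMod m) × T)) inferInstance
    inferInstance).1 (exists_surjective_to_abelianization eG _ (reduceFree_surjective _ T m))
  obtain ⟨g, hg⟩ := exists_surjective_of_abelianization eH f hf
  exact exists_surjective_of_nsmul_eq_zero (nsmul_modEq_zero hT) g hg

theorem exists_addEquiv_free_prod_finite (A : Type*) [AddCommGroup A] [AddGroup.FG A] :
    ∃ (r : ℕ) (T : Type) (_ : AddCommGroup T) (_ : Finite T),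
      Nonempty (A ≃+ (Fin r → ℤ) × T) := by
  obtain ⟨r, ι, _, p, hp, e, ⟨f⟩⟩ := AddCommGroup.equiv_free_prod_directSum_zmod A
  classical
  have : ∀ i, NeZero (p i ^ e i) := fun i => ⟨pow_ne_zero _ (hp i).ne_zero⟩
  exact ⟨r, ∀ i, ZMod (p i ^ e i), inferInstance, inferInstance,
    ⟨f.trans (Finsupp.addEquivFunOnFinite.prodCongr (DirectSum.addEquivProd _))⟩⟩

theorem SameFiniteQuotients.symm {G H : Type*} [Group G] [Group H]
    (h : SameFiniteQuotients G H) : SameFiniteQuotients H G :=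
  fun Q hQ hfin => (h Q hQ hfin).symm

/-- The finite quotients of a finitely generated group determine its
abelianisation. -/
theorem profinite_detects_abelianization (G H : Type) [Group G] [Group H]
    [Group.FG G] [Group.FG H] (h : SameFiniteQuotients G H) :
    Nonempty (Abelianization G ≃* Abelianization H) := by
  have hGfg : Group.FG (Abelianization G) := QuotientGroup.fg _
  have hHfg : Group.FG (Abelianization H) := QuotientGroup.fg _
  obtain ⟨r, T, _, _, ⟨eG⟩⟩ := exists_addEquiv_free_prod_finite (Additive (Abelianization G))
  obtain ⟨s, U, _, _, ⟨eH⟩⟩ := exists_addEquiv_free_prod_finite (Additive (Abelianization H))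
  have hT0 : Nat.card T ≠ 0 := Nat.card_pos.ne'
  have hU0 : Nat.card U ≠ 0 := Nat.card_pos.ne'
  obtain ⟨N, hN⟩ : ∃ N, N = Nat.card T * Nat.card U := ⟨_, rfl⟩
  have hN0 : N ≠ 0 := hN ▸ mul_ne_zero hT0 hU0
  have hT : ∀ k, ∀ t : T, (k * N) • t = 0 := fun k t => by
    rw [hN, mul_left_comm, mul_nsmul, card_nsmul_eq_zero', nsmul_zero]
  have hU : ∀ k, ∀ u : U, (k * N) • u = 0 := fun k u => by
    rw [hN, ← mul_assoc, mul_nsmul', card_nsmul_eq_zero', nsmul_zero]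
  have hcard : ∀ k, k ≠ 0 → (k * N) ^ s * Nat.card U = (k * N) ^ r * Nat.card T := by
    intro k hk
    have : NeZero (k * N) := ⟨mul_ne_zero hk hN0⟩
    obtain ⟨f, hf⟩ := exists_surjective_reduction h eG eH (hT k)
    obtain ⟨g, hg⟩ := exists_surjective_reduction h.symm eH eG (hU k)
    simpa using (Nat.card_le_card_of_surjective g hg).antisymm
      (Nat.card_le_card_of_surjective f hf)
  obtain rfl : s = r := by
    have h₁ := hcard 1 one_ne_zero
    have h₂ := hcard 2 two_ne_zero
    rw [one_mul] at h₁
    rw [mul_pow, mul_pow, mul_assoc, mul_assoc, h₁] at h₂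
    exact Nat.pow_right_injective le_rfl
      (Nat.eq_of_mul_eq_mul_right (Nat.pos_of_ne_zero (mul_ne_zero (pow_ne_zero r hN0) hT0)) h₂)
  have : NeZero (N * N) := ⟨mul_ne_zero hN0 hN0⟩
  obtain ⟨f, hf⟩ := exists_surjective_reduction h eG eH (hT N)
  have hTU : Nat.card U = Nat.card T :=
    Nat.eq_of_mul_eq_mul_left (Nat.pos_of_ne_zero (pow_ne_zero s (mul_ne_zero hN0 hN0)))
      (hcard N hN0)
  have hbij : Function.Bijective f :=
    (Nat.bijective_iff_surjective_and_card f).2 ⟨hf, by simp [hTU]⟩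
  let F := AddEquiv.ofBijective f hbij
  have hinj := injective_snd_of_addEquiv hN0 (by simpa using hU 1) F
  let g : U →+ T := (AddMonoidHom.snd _ _).comp (f.comp (AddMonoidHom.inr _ _))
  have hg : Function.Bijective g := (Nat.bijective_iff_injective_and_card g).2 ⟨hinj, hTU⟩
  exact ⟨MulEquiv.toAdditive.symm
    ((eG.trans ((AddEquiv.refl _).prodCongr (AddEquiv.ofBijective g hg).symm)).trans eH.symm)⟩
end

section
/- Let φ₀ be the automorphism of the free group F₃ on generators a, b, c determined by a ↦ b, b ↦ c, c ↦ c·a⁻¹, let G = F₃ ⋊_{φ₀} ℤ, and let s be a natural number with ψ an automorphism of F_s such that H = F_s ⋊_ψ ℤ has the same finite quotients as G. Then H has first Betti number 1. -/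
/-- A homomorphism from `F₃ ⋊_{φ₀} ℤ` to a commutative group kills the free fibre. -/
lemma hom_phi0_inl_eq_one {A : Type*} [CommGroup A] (f : FreeByCyclic phi0 →* A)
    (x : FreeGroup (Fin 3)) : f (SemidirectProduct.inl x) = 1 := by
  let F : FreeGroup (Fin 3) →* A := f.comp SemidirectProduct.inl
  have invariant (y : FreeGroup (Fin 3)) : F (phi0 y) = F y := by
    have := congrArg f (SemidirectProduct.inl_aut
      (φ := zpowersHom (MulAut (FreeGroup (Fin 3))) phi0) (Multiplicative.ofAdd 1) y)
    rw [map_mul, map_mul, mul_right_comm, ← map_mul, ← map_mul, map_inv, mul_inv_cancel,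
      one_mul] at this
    rwa [zpowersHom_apply, toAdd_ofAdd, zpow_one] at this
  have h0 : F (FreeGroup.of 1) = F (FreeGroup.of 0) := by
    simpa [phi0, phi0Fun] using invariant (FreeGroup.of 0)
  have h1 : F (FreeGroup.of 2) = F (FreeGroup.of 1) := by
    simpa [phi0, phi0Fun] using invariant (FreeGroup.of 1)
  have h2 : F (FreeGroup.of 0) = 1 := by
    have h := invariant (FreeGroup.of 2)
    have e : phi0 (FreeGroup.of 2) = FreeGroup.of 2 * (FreeGroup.of 0)⁻¹ := by
      simp [phi0, phi0Fun]
    rw [e, map_mul, map_inv] at h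
    simpa using h
  have key : F = 1 := by
    ext i
    fin_cases i
    · exact h2
    · exact h0.trans h2
    · exact h1.trans (h0.trans h2)
  exact DFunLike.congr_fun key x

/-- A homomorphism from `F₃ ⋊_{φ₀} ℤ` to a commutative group has cyclic image. -/
lemma hom_phi0_isCyclic {A : Type*} [CommGroup A] (f : FreeByCyclic phi0 →* A)
    (hf : Function.Surjective f) : IsCyclic A := by
  refine isCyclic_of_surjective (f.comp SemidirectProduct.inr) fun a => ?_
  obtain ⟨g, rfl⟩ := hf a
  refine ⟨g.right, ?_⟩
  conv_rhs => rw [← SemidirectProduct.inl_left_mul_inr_right g, map_mul, hom_phi0_inl_eq_one]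
  simp

/-- The Klein four-group is not cyclic. -/
lemma not_isCyclic_zmod_two_prod : ¬ IsCyclic (Multiplicative (ZMod 2 × ZMod 2)) := by
  intro h
  have hc := IsCyclic.exponent_eq_card (α := Multiplicative (ZMod 2 × ZMod 2))
  have hd : Monoid.exponent (Multiplicative (ZMod 2 × ZMod 2)) ∣ 2 :=
    Monoid.exponent_dvd_of_forall_pow_eq_one (by decide)
  rw [hc] at hd
  simp at hd

/-- Any free-by-cyclic group with the same finite quotients as
`G = F₃ ⋊_{φ₀} ℤ` has first Betti number 1. -/
theorem profinite_companion_firstBettiOne (s : ℕ) (ψ : MulAut (FreeGroup (Fin s)))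
    (h : SameFiniteQuotients (FreeByCyclic ψ) (FreeByCyclic phi0)) :
    FirstBettiOne (FreeByCyclic ψ) := by
  refine ⟨⟨SemidirectProduct.rightHom, SemidirectProduct.rightHom_surjective⟩, ?_⟩
  rintro ⟨f, hf⟩
  let r : Multiplicative (ℤ × ℤ) →* Multiplicative (ZMod 2 × ZMod 2) :=
    AddMonoidHom.toMultiplicative
      ((Int.castAddHom (ZMod 2)).prodMap (Int.castAddHom (ZMod 2)))
  have hr : Function.Surjective r :=
    Function.Surjective.prodMap (ZMod.intCast_surjective (n := 2))
      (ZMod.intCast_surjective (n := 2))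
  obtain ⟨g, hg⟩ := (h (Multiplicative (ZMod 2 × ZMod 2)) inferInstance inferInstance).mp
    ⟨r.comp f, hr.comp hf⟩
  exact not_isCyclic_zmod_two_prod (hom_phi0_isCyclic g hg)
end
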